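/- There exists an absolute constant c > 0 such that for every w ∈ ℕ there exist a finite metric space M = (M,d) and a starting point s ∈ M such that c·w² is a distributional lower bound for MSS on M with starting point s restricted to request sequences whose request sets all have cardinality at most w. (Via the standard reductions, this implies that the randomized competitive ratio for width-w layered graph traversal is Ω(w²), matching the known O(w²) upper bound.) -/

import Mathlib

open scoped Classical

/-- `d` is a metric on `M`. -/
def IsMetric {M : Type*} (d : M → M → ℝ) : Prop :=
  (∀ x y, d x y = 0 ↔ x = y) ∧ (∀ x y, d x y = d y x) ∧
    ∀ x y z, d x z ≤ d x y + d y z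

/-- The point occupied by the online algorithm `A` (with starting point `s`)
after serving the first `t` requests of `σ`. -/
def mssPoint {M : Type*} (A : List (Finset M) → M) (s : M)
    (σ : List (Finset M)) (t : ℕ) : M :=
  if t = 0 then s else A (σ.take t)

/-- The cost of the deterministic online algorithm `A` on the MSS request
sequence `σ`, starting at `s`. -/
def mssCost {M : Type*} (d : M → M → ℝ) (A : List (Finset M) → M) (s : M)
    (σ : List (Finset M)) : ℝ :=
  ∑ t ∈ Finset.range σ.length, d (mssPoint A s σ t) (mssPoint A s σ (t + 1))

/-- `A` is a valid deterministic online algorithm for MSS: after each (nonempty)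
prefix, it occupies a point of the last request. -/
def MssAlg {M : Type*} (A : List (Finset M) → M) : Prop :=
  ∀ (l : List (Finset M)) (r : Finset M), r.Nonempty → A (l ++ [r]) ∈ r

/-- `x` is a feasible (offline) point sequence serving `σ` from `s`. -/
def MssServes {M : Type*} (s : M) (σ : List (Finset M)) (x : ℕ → M) : Prop :=
  x 0 = s ∧ ∀ (t : ℕ) (h : t < σ.length), x (t + 1) ∈ σ.get ⟨t, h⟩

/-- Optimal (offline) cost of serving `σ` from `s`. -/
noncomputable def mssOpt {M : Type*} (d : M → M → ℝ) (s : M)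
    (σ : List (Finset M)) : ℝ :=
  sInf {c | ∃ x : ℕ → M, MssServes s σ x ∧
    c = ∑ t ∈ Finset.range σ.length, d (x t) (x (t + 1))}

/-- `C` is a distributional lower bound for MSS on `(M,d)` with starting point `s`
and request sets of size at most `w`. -/
def MssDLB {M : Type*} (d : M → M → ℝ) (s : M) (w : ℕ) (C : ℝ) : Prop :=
  ∀ B : ℝ, 0 ≤ B → ∃ (N : ℕ) (P : Fin N → ℝ) (ρ : Fin N → List (Finset M)),
    (∀ ω, 0 ≤ P ω) ∧ (∑ ω, P ω) = 1 ∧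
    (∀ ω, ∀ r ∈ ρ ω, r.Nonempty ∧ r.card ≤ w) ∧
    B ≤ (∑ ω, P ω * mssOpt d s (ρ ω)) ∧
    ∀ A : List (Finset M) → M, MssAlg A →
      C * (∑ ω, P ω * mssOpt d s (ρ ω)) ≤ ∑ ω, P ω * mssCost d A s (ρ ω)

/-! ### Randomized request sequences -/

/-- A finite randomized request sequence over `M` driven by fair coins, with outcomes labelled
by `F`. -/
inductive Adversary (M F : Type) : Type
  | done (e : F) : Adversary M F
  | req (r : Finset M) (n : Adversary M F) : Adversary M F
  | flip (a b : Adversary M F) : Adversary M F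

namespace Adversary

variable {M M' F F' : Type}

/-- Expectation of a function of the request sequence and the outcome label. -/
noncomputable def expect : Adversary M F → (List (Finset M) → F → ℝ) → ℝ
  | done e, g => g [] e
  | req r n, g => n.expect fun l e => g (r :: l) e
  | flip a b, g => (a.expect g + b.expect g) / 2

/-- A property holds for every possible request sequence and its outcome label. -/
def Forall : Adversary M F → (List (Finset M) → F → Prop) → Prop
  | done e, Q => Q [] e
  | req r n, Q => n.Forall fun l e => Q (r :: l) e
  | flip a b, Q => a.Forall Q ∧ b.Forall Q

/-- A property holds for every request that may be issued. -/
def ForallReq : Adversary M F → (Finset M → Prop) → Prop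
  | done _, _ => True
  | req r n, Q => Q r ∧ n.ForallReq Q
  | flip a b, Q => a.ForallReq Q ∧ b.ForallReq Q

/-- Transform all requests by `φ` and continue at the outcome `e` with `k e`. -/
def graft (φ : Finset M → Finset M') (k : F → Adversary M' F') : Adversary M F → Adversary M' F'
  | done e => k e
  | req r n => req (φ r) (n.graft φ k)
  | flip a b => flip (a.graft φ k) (b.graft φ k)

/-- Copy a request along `f`, offering the points of `O` in addition. -/
noncomputable def offer (f : M → M') (O : Finset M') (r : Finset M) : Finset M' := r.image f ∪ O

theorem mem_offer {f : M → M'} {O : Finset M'} {r : Finset M} {y : M'} :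
    y ∈ offer f O r ↔ (∃ x ∈ r, f x = y) ∨ y ∈ O := by
  simp [offer]

theorem card_offer_le {f : M → M'} {O : Finset M'} {r : Finset M} :
    (offer f O r).card ≤ r.card + O.card :=
  (Finset.card_union_le _ _).trans (Nat.add_le_add_right Finset.card_image_le _)

/-- The least expected cost, from the position `x`, of an online player who observes the coins
and may quit at any request for the price `P`. -/
noncomputable def escapeValue (d : M → M → ℝ) (P : ℝ) : Adversary M F → M → ℝ
  | done _, _ => 0
  | req r n, x =>
      if hr : r.Nonempty then min P (r.inf' hr fun y => d x y + n.escapeValue d P y) else P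
  | flip a b, x => (a.escapeValue d P x + b.escapeValue d P x) / 2

theorem Forall.mono {T : Adversary M F} {Q R : List (Finset M) → F → Prop} (h : T.Forall Q)
    (hQR : ∀ l e, Q l e → R l e) : T.Forall R := by
  induction T generalizing Q R with
  | done e => exact hQR _ _ h
  | req r n ih => exact ih h fun l e => hQR _ _
  | flip a b iha ihb => exact ⟨iha h.1 hQR, ihb h.2 hQR⟩

theorem Forall.and {T : Adversary M F} {Q R : List (Finset M) → F → Prop} (h : T.Forall Q)
    (h' : T.Forall R) : T.Forall fun l e => Q l e ∧ R l e := by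
  induction T generalizing Q R with
  | done e => exact ⟨h, h'⟩
  | req r n ih => exact ih h h'
  | flip a b iha ihb => exact ⟨iha h.1 h'.1, ihb h.2 h'.2⟩

theorem ForallReq.mono {T : Adversary M F} {Q R : Finset M → Prop} (h : T.ForallReq Q)
    (hQR : ∀ r, Q r → R r) : T.ForallReq R := by
  induction T with
  | done e => trivial
  | req r n ih => exact ⟨hQR _ h.1, ih h.2⟩
  | flip a b iha ihb => exact ⟨iha h.1, ihb h.2⟩

theorem ForallReq.forall_mem {T : Adversary M F} {Q : Finset M → Prop} (h : T.ForallReq Q) :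
    T.Forall fun l _ => ∀ r ∈ l, Q r := by
  induction T with
  | done e => simp [Forall]
  | req r n ih =>
    exact (ih h.2).mono fun l e hl => by
      simpa using ⟨h.1, hl⟩
  | flip a b iha ihb => exact ⟨iha h.1, ihb h.2⟩

theorem forall_graft {T : Adversary M F} {φ : Finset M → Finset M'} {k : F → Adversary M' F'}
    {Q : List (Finset M') → F' → Prop} :
    (T.graft φ k).Forall Q ↔
      T.Forall fun l e => (k e).Forall fun l' e' => Q (l.map φ ++ l') e' := by
  induction T generalizing Q with
  | done e => simp [graft, Forall]
  | req r n ih => simp [graft, Forall, ih]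
  | flip a b iha ihb => simp [graft, Forall, iha, ihb]

theorem forallReq_graft {T : Adversary M F} {φ : Finset M → Finset M'}
    {k : F → Adversary M' F'} {Q : Finset M' → Prop} (h : T.ForallReq fun r => Q (φ r))
    (h' : T.Forall fun _ e => (k e).ForallReq Q) : (T.graft φ k).ForallReq Q := by
  induction T with
  | done e => exact h'
  | req r n ih => exact ⟨h.1, ih h.2 h'⟩
  | flip a b iha ihb => exact ⟨iha h.1 h'.1, ihb h.2 h'.2⟩

theorem expect_graft {T : Adversary M F} {φ : Finset M → Finset M'} {k : F → Adversary M' F'}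
    {g : List (Finset M') → F' → ℝ} :
    (T.graft φ k).expect g =
      T.expect fun l e => (k e).expect fun l' e' => g (l.map φ ++ l') e' := by
  induction T generalizing g with
  | done e => simp [graft, expect]
  | req r n ih => simp [graft, expect, ih]
  | flip a b iha ihb => simp [graft, expect, iha, ihb]

theorem expect_mono {T : Adversary M F} {f g : List (Finset M) → F → ℝ}
    (h : T.Forall fun l e => f l e ≤ g l e) : T.expect f ≤ T.expect g := by
  induction T generalizing f g with
  | done e => exact h
  | req r n ih => exact ih h
  | flip a b iha ihb =>
    have h₁ := iha h.1
    have h₂ := ihb h.2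
    simp only [expect]
    linarith

theorem expect_congr {T : Adversary M F} {f g : List (Finset M) → F → ℝ}
    (h : T.Forall fun l e => f l e = g l e) : T.expect f = T.expect g :=
  le_antisymm (expect_mono (h.mono fun _ _ => le_of_eq))
    (expect_mono (h.mono fun _ _ => ge_of_eq))

theorem expect_add (T : Adversary M F) (f g : List (Finset M) → F → ℝ) :
    T.expect (fun l e => f l e + g l e) = T.expect f + T.expect g := by
  induction T generalizing f g with
  | done e => rfl
  | req r n ih => exact ih _ _
  | flip a b iha ihb => simp only [expect, iha, ihb]; ring

theorem expect_mul (T : Adversary M F) (c : ℝ) (f : List (Finset M) → F → ℝ) :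
    T.expect (fun l e => c * f l e) = c * T.expect f := by
  induction T generalizing f with
  | done e => rfl
  | req r n ih => exact ih _
  | flip a b iha ihb => simp only [expect, iha, ihb]; ring

@[simp]
theorem expect_const (T : Adversary M F) (c : ℝ) : T.expect (fun _ _ => c) = c := by
  induction T with
  | done e => rfl
  | req r n ih => exact ih
  | flip a b iha ihb => simp only [expect, iha, ihb]; ring

theorem expect_affine (T : Adversary M F) (c c' : ℝ) (f : List (Finset M) → F → ℝ) :
    T.expect (fun l e => c + c' * f l e) = c + c' * T.expect f := by
  rw [expect_add, expect_mul, expect_const]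

theorem le_escapeValue_req {d : M → M → ℝ} {P u : ℝ} {r : Finset M} {n : Adversary M F} {x : M}
    (hP : u ≤ P) (h : ∀ y ∈ r, u ≤ d x y + n.escapeValue d P y) :
    u ≤ (req r n).escapeValue d P x := by
  rw [escapeValue]
  split_ifs
  · exact le_min hP (Finset.le_inf' _ _ h)
  · exact hP

theorem escapeValue_req_le {d : M → M → ℝ} {P : ℝ} {r : Finset M} {n : Adversary M F} {x y : M}
    (hy : y ∈ r) : (req r n).escapeValue d P x ≤ d x y + n.escapeValue d P y := by
  rw [escapeValue, dif_pos ⟨y, hy⟩]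
  exact (min_le_right _ _).trans (Finset.inf'_le _ hy)

theorem escapeValue_req_le_price {d : M → M → ℝ} {P : ℝ} {r : Finset M} {n : Adversary M F}
    {x : M} : (req r n).escapeValue d P x ≤ P := by
  rw [escapeValue]
  split_ifs
  · exact min_le_left _ _
  · exact le_rfl

theorem le_escapeValue_graft {d : M' → M' → ℝ} (hd : ∀ x y, 0 ≤ d x y) {P : ℝ}
    {T : Adversary M F} {φ : Finset M → Finset M'} {k : F → Adversary M' F'} {Ψ : F → ℝ}
    (h : T.Forall fun _ e => Ψ e ≤ P ∧ ∀ y, Ψ e ≤ (k e).escapeValue d P y) (x : M') :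
    T.expect (fun _ e => Ψ e) ≤ (T.graft φ k).escapeValue d P x := by
  induction T generalizing x with
  | done e => exact h.2 x
  | req r n ih =>
    refine le_escapeValue_req ?_ fun y _ => ?_
    · exact (expect_mono (g := fun _ _ => P) (h.mono fun l e he => he.1)).trans_eq
        (expect_const _ _)
    · have := ih h y
      have := hd x y
      simp only [expect]
      linarith
  | flip a b iha ihb =>
    have h₁ := iha h.1 x
    have h₂ := ihb h.2 x
    simp only [expect, graft, escapeValue]
    linarith

/-- Grafting a request sequence played in an isometric copy (`f`) of `M`, in which the points of
`O` at distance at least `P` are offered as a refuge, adds the escape value to the expected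
continuation value. -/
theorem escapeValue_add_le_graft {d : M → M → ℝ} {d' : M' → M' → ℝ} (hd : ∀ x y, 0 ≤ d' x y)
    {P P' : ℝ} {S : Set M} {f : M → M'} {O : Finset M'}
    (hf : ∀ x y, d' (f x) (f y) = d x y) (hO : ∀ x ∈ S, ∀ y ∈ O, P ≤ d' (f x) y)
    {T : Adversary M F} (hS : T.ForallReq fun r => ∀ y ∈ r, y ∈ S)
    {k : F → Adversary M' F'} {Ψ : F → ℝ}
    (h : T.Forall fun _ e => Ψ e ≤ P' ∧ P + Ψ e ≤ P' ∧ ∀ y, Ψ e ≤ (k e).escapeValue d' P' y)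
    {x : M} (hx : x ∈ S) :
    T.escapeValue d P x + T.expect (fun _ e => Ψ e) ≤
      (T.graft (offer f O) k).escapeValue d' P' (f x) := by
  induction T generalizing x with
  | done e => simpa [escapeValue, expect, graft] using h.2.2 (f x)
  | req r n ih =>
    have hq : ∀ y, n.expect (fun _ e => Ψ e) ≤
        (n.graft (offer f O) k).escapeValue d' P' y :=
      le_escapeValue_graft hd (Forall.mono (Q := _) (T := n) h fun l e he => ⟨he.1, he.2.2⟩)
    have hle : (req r n).escapeValue d P x ≤ P := escapeValue_req_le_price
    refine le_escapeValue_req ?_ fun y hy => ?_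
    · have h1 : n.expect (fun _ e => P + 1 * Ψ e) ≤ n.expect fun _ _ => P' :=
        expect_mono (Forall.mono (Q := _) (T := n) h fun l e he => by linarith [he.2.1])
      rw [expect_affine, expect_const] at h1
      simp only [expect]
      linarith
    · rw [mem_offer] at hy
      rcases hy with ⟨y, hy, rfl⟩ | hy
      · have h1 := ih hS.2 h (hS.1 y hy)
        have h2 := escapeValue_req_le (d := d) (P := P) (n := n) (x := x) hy
        simp only [expect]
        rw [hf]
        linarith
      · have h1 := hO x hx y hy
        have h2 := hq y
        simp only [expect]
        linarith
  | flip a b iha ihb =>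
    have h₁ := iha hS.1 h.1 hx
    have h₂ := ihb hS.2 h.2 hx
    simp only [expect, graft, escapeValue]
    linarith

/-- The law of the request sequence is a finitely supported probability distribution. -/
theorem exists_distribution (T : Adversary M F) :
    ∃ (N : ℕ) (P : Fin N → ℝ) (ρ : Fin N → List (Finset M)), (∀ ω, 0 ≤ P ω) ∧
      (∀ g : List (Finset M) → ℝ, ∑ ω, P ω * g (ρ ω) = T.expect fun l _ => g l) ∧
      ∀ Q : List (Finset M) → Prop, (T.Forall fun l _ => Q l) → ∀ ω, Q (ρ ω) := by
  induction T with
  | done e => exact ⟨1, fun _ => 1, fun _ => [], by simp, by simp [expect], fun Q h _ => h⟩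
  | req r n ih =>
    obtain ⟨N, P, ρ, h0, hE, hQ⟩ := ih
    exact ⟨N, P, fun ω => r :: ρ ω, h0, fun g => hE fun l => g (r :: l),
      fun Q h => hQ (fun l => Q (r :: l)) h⟩
  | flip a b iha ihb =>
    obtain ⟨N, P, ρ, h0, hE, hQ⟩ := iha
    obtain ⟨N', P', ρ', h0', hE', hQ'⟩ := ihb
    refine ⟨N + N', Fin.append (fun ω => P ω / 2) (fun ω => P' ω / 2), Fin.append ρ ρ',
      ?_, fun g => ?_, fun Q h => ?_⟩
    · refine Fin.addCases (fun i => ?_) fun i => ?_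
      · rw [Fin.append_left]; exact div_nonneg (h0 i) zero_le_two
      · rw [Fin.append_right]; exact div_nonneg (h0' i) zero_le_two
    · simp only [Fin.sum_univ_add, Fin.append_left, Fin.append_right, expect, ← hE, ← hE',
        add_div, Finset.sum_div, div_mul_eq_mul_div]
    · refine Fin.addCases (fun i => ?_) fun i => ?_
      · simpa using hQ Q h.1 i
      · simpa using hQ' Q h.2 i

end Adversary

open Adversary

theorem IsMetric.nonneg {M : Type*} {d : M → M → ℝ} (hd : IsMetric d) (x y : M) : 0 ≤ d x y := by
  have h := hd.2.2 x y x
  rw [(hd.1 x x).2 rfl, hd.2.1 y x] at h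
  linarith

/-- `Serves d l x y c`: starting from `x`, the requests `l` can be served offline at cost at most
`c` with final position `y`. -/
def Serves {M : Type} (d : M → M → ℝ) : List (Finset M) → M → M → ℝ → Prop
  | [], x, y, c => x = y ∧ 0 ≤ c
  | r :: l, x, y, c => ∃ z ∈ r, Serves d l z y (c - d x z)

namespace Serves

variable {M M' : Type} {d : M → M → ℝ} {d' : M' → M' → ℝ}

theorem mono {l : List (Finset M)} {x y : M} {c c' : ℝ} (h : Serves d l x y c) (hc : c ≤ c') :
    Serves d l x y c' := by
  induction l generalizing x c c' with
  | nil => exact ⟨h.1, h.2.trans hc⟩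
  | cons r l ih =>
    obtain ⟨z, hz, h⟩ := h
    exact ⟨z, hz, ih h (by linarith)⟩

theorem append {l l' : List (Finset M)} {x y z : M} {c c' : ℝ} (h : Serves d l x y c)
    (h' : Serves d l' y z c') : Serves d (l ++ l') x z (c + c') := by
  induction l generalizing x c with
  | nil =>
    obtain ⟨rfl, hc⟩ := h
    exact h'.mono (by linarith)
  | cons r l ih =>
    obtain ⟨v, hv, h⟩ := h
    exact ⟨v, hv, (ih h).mono (by linarith)⟩

theorem cons {l : List (Finset M)} {x y : M} {c : ℝ} {r : Finset M} (hd : IsMetric d)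
    (hx : x ∈ r) (h : Serves d l x y c) : Serves d (r :: l) x y c :=
  ⟨x, hx, h.mono (by simp [(hd.1 x x).2 rfl])⟩

theorem exists_of_append {l l' : List (Finset M)} {x y : M} {c : ℝ} (hd : IsMetric d)
    (h : Serves d (l ++ l') x y c) : ∃ z, Serves d l' z y c := by
  induction l generalizing x c with
  | nil => exact ⟨x, h⟩
  | cons r l ih =>
    obtain ⟨v, _, h⟩ := h
    exact ih (h.mono (by linarith [hd.nonneg x v]))

theorem dist_le {l : List (Finset M)} {x y : M} {c : ℝ} (hd : IsMetric d)
    (h : Serves d l x y c) : d x y ≤ c := by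
  induction l generalizing x c with
  | nil =>
    obtain ⟨rfl, hc⟩ := h
    rwa [(hd.1 x x).2 rfl]
  | cons r l ih =>
    obtain ⟨v, _, h⟩ := h
    linarith [ih h, hd.2.2 x v y]

theorem image_union {f : M → M'} (hf : ∀ x y, d' (f x) (f y) = d x y) (O : Finset M')
    {l : List (Finset M)} {x y : M} {c : ℝ} (h : Serves d l x y c) :
    Serves d' (l.map (offer f O)) (f x) (f y) c := by
  induction l generalizing x c with
  | nil => exact ⟨congrArg f h.1, h.2⟩
  | cons r l ih =>
    obtain ⟨z, hz, h⟩ := h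
    exact ⟨f z, mem_offer.2 (.inl ⟨z, hz, rfl⟩), by rw [hf]; exact ih h⟩

theorem stay (hd : IsMetric d') {f : M → M'} {O : Finset M'} {x : M'} (hx : x ∈ O)
    (l : List (Finset M)) : Serves d' (l.map (offer f O)) x x 0 := by
  induction l with
  | nil => exact ⟨rfl, le_rfl⟩
  | cons r l ih => exact ⟨x, mem_offer.2 (.inr hx), ih.mono (by simp [(hd.1 x x).2 rfl])⟩

end Serves

/-- A metric space with a 1-Lipschitz height function and upward shifts. -/
structure Arena (X : Type) where
  /-- the metric -/
  d : X → X → ℝ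
  /-- the height -/
  h : X → ℝ
  /-- moving upwards by a given amount -/
  up : X → ℝ → X
  /-- a base point -/
  base : X
  isMetric : IsMetric d
  height_sub_le : ∀ x y, h x - h y ≤ d x y
  dist_up : ∀ x δ, 0 ≤ δ → d x (up x δ) = δ
  height_up : ∀ x δ, h (up x δ) = h x + δ

/-- The real line as an arena. -/
def Arena.real : Arena ℝ where
  d x y := |x - y|
  h := id
  up x δ := x + δ
  base := 0
  isMetric := ⟨fun x y => by simp [sub_eq_zero], abs_sub_comm, abs_sub_le⟩
  height_sub_le x y := le_abs_self _
  dist_up x δ hδ := by simp [abs_of_nonneg hδ]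
  height_up _ _ := rfl

/-- The `ℓ¹`-square of an arena. -/
def Arena.square {X : Type} (𝓐 : Arena X) : Arena (X × X) where
  d x y := 𝓐.d x.1 y.1 + 𝓐.d x.2 y.2
  h x := 𝓐.h x.1 + 𝓐.h x.2
  up x δ := (𝓐.up x.1 δ, x.2)
  base := (𝓐.base, 𝓐.base)
  isMetric := by
    have hd := 𝓐.isMetric
    refine ⟨fun x y => ⟨fun h => ?_, ?_⟩, fun x y => ?_, fun x y z => ?_⟩
    · have h1 := hd.nonneg x.1 y.1
      have h2 := hd.nonneg x.2 y.2
      exact Prod.ext ((hd.1 _ _).1 (by linarith)) ((hd.1 _ _).1 (by linarith))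
    · rintro rfl
      simp [(hd.1 _ _).2]
    · simp only [hd.2.1 x.1 y.1, hd.2.1 x.2 y.2]
    · linarith [hd.2.2 x.1 y.1 z.1, hd.2.2 x.2 y.2 z.2]
  height_sub_le x y := by linarith [𝓐.height_sub_le x.1 y.1, 𝓐.height_sub_le x.2 y.2]
  dist_up x δ hδ := by
    simp only [𝓐.dist_up x.1 δ hδ, (𝓐.isMetric.1 x.2 x.2).2 rfl, add_zero]
  height_up x δ := by simp only [𝓐.height_up]; ring

theorem Arena.square_dist_left {X : Type} (𝓐 : Arena X) (b x y : X) :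
    𝓐.square.d (x, b) (y, b) = 𝓐.d x y := by
  simp [Arena.square, (𝓐.isMetric.1 b b).2]

theorem Arena.square_dist_right {X : Type} (𝓐 : Arena X) (a x y : X) :
    𝓐.square.d (a, x) (a, y) = 𝓐.d x y := by
  simp [Arena.square, (𝓐.isMetric.1 a a).2]

/-- A family of randomized request sequences of width `w`, started at an arbitrary point and at an
arbitrary scale `s`, with random upward progress of expectation in `[s / 2, s]`. The progress
pays for the optimal cost, whereas the online cost is at least `q ^ 2 * s` even if
the player may quit for the price `(1280 * q) ^ 2 * s`. -/
structure IsGadget {X : Type} (𝓐 : Arena X) (w : ℕ) (q z : ℝ) (G : X → ℝ → Adversary X X) :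
    Prop where
  forallReq : ∀ v s, 0 < s →
    (G v s).ForallReq fun r => r.Nonempty ∧ r.card ≤ w ∧ ∀ y ∈ r, 𝓐.h v ≤ 𝓐.h y
  serves : ∀ v s, 0 < s → (G v s).Forall fun l e => Serves 𝓐.d l v e (𝓐.h e - 𝓐.h v)
  progress : ∀ v s, 0 < s →
    (G v s).Forall fun _ e => z * s ≤ 𝓐.h e - 𝓐.h v ∧ 𝓐.h e - 𝓐.h v ≤ 2 * s
  expect_le : ∀ v s, 0 < s → (G v s).expect (fun _ e => 𝓐.h e - 𝓐.h v) ≤ s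
  le_expect : ∀ v s, 0 < s → s / 2 ≤ (G v s).expect (fun _ e => 𝓐.h e - 𝓐.h v)
  expect_eq : ∀ v v' s, 0 < s → ∀ f : ℝ → ℝ, (G v s).expect (fun _ e => f (𝓐.h e - 𝓐.h v)) =
    (G v' s).expect (fun _ e => f (𝓐.h e - 𝓐.h v'))
  le_escapeValue : ∀ v s, 0 < s → q ^ 2 * s ≤ (G v s).escapeValue 𝓐.d ((1280 * q) ^ 2 * s) v

theorem isGadget_real :
    IsGadget Arena.real 1 1 1 fun v s => req {Arena.real.up v s} (done (Arena.real.up v s)) where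
  forallReq v s hs := ⟨by simp [Arena.height_up, hs.le], trivial⟩
  serves v s hs := by
    simp [Adversary.Forall, Serves, Arena.height_up, Arena.dist_up _ _ _ hs.le]
  progress v s hs := by
    simp only [Adversary.Forall, Arena.height_up]
    constructor <;> linarith
  expect_le v s hs := by simp [expect, Arena.height_up]
  le_expect v s hs := by simp [expect, Arena.height_up, hs.le]
  expect_eq v v' s hs f := by simp [expect, Arena.height_up]
  le_escapeValue v s hs := by
    refine le_escapeValue_req (by linarith) fun y hy => ?_
    rw [Finset.mem_singleton.1 hy, Arena.dist_up _ _ _ hs.le]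
    simp [escapeValue]

section Race

variable {X : Type} (𝓐 : Arena X) (G : X → ℝ → Adversary X X) (p s : ℝ) (a b : X)

/-- The total progress of the two racers. -/
def raceGap (a' b' : X) : ℝ := (𝓐.h a' - 𝓐.h a) + (𝓐.h b' - 𝓐.h b)

/-- The end of a race: only the racer with the smaller progress survives. -/
noncomputable def settle (a' b' : X) : Adversary (X × X) (X × X) :=
  if 𝓐.h a' - 𝓐.h a ≤ 𝓐.h b' - 𝓐.h b then req {(a', b)} (done (a', b))
  else req {(a, b')} (done (a, b'))

/-- A race between `(a', b)` and `(a, b')`: as long as the total progress `x` is below `s`, a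
random one of them is moved by `G` at scale `x / p`, while the other one stays. -/
noncomputable def race : ℕ → X → X → Adversary (X × X) (X × X)
  | 0, a', b' => req {(a', b), (a, b')} (settle 𝓐 a b a' b')
  | n + 1, a', b' => req {(a', b), (a, b')} <|
      if s ≤ raceGap 𝓐 a b a' b' then settle 𝓐 a b a' b'
      else flip
        ((G a' (raceGap 𝓐 a b a' b' / p)).graft (offer (fun y => (y, b)) {(a, b')})
          fun e => race n e b')
        ((G b' (raceGap 𝓐 a b a' b' / p)).graft (offer (fun y => (a, y)) {(a', b)})
          fun e => race n a' e)

/-- The invariant of a race with at most `n` rounds to go. -/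
structure RaceInv (z y₀ : ℝ) (n : ℕ) (a' b' : X) : Prop where
  left : y₀ ≤ 𝓐.h a' - 𝓐.h a
  right : y₀ ≤ 𝓐.h b' - 𝓐.h b
  le : raceGap 𝓐 a b a' b' ≤ s * (1 + 2 / p)
  fuel : s ≤ raceGap 𝓐 a b a' b' + n * (y₀ * z / p)

variable {𝓐 G p s a b} {w : ℕ} {q z y₀ : ℝ}

theorem RaceInv.gap_pos (hy : 0 < y₀) {n : ℕ} {a' b' : X}
    (h : RaceInv 𝓐 p s a b z y₀ n a' b') : 0 < raceGap 𝓐 a b a' b' := by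
  have h1 := h.left
  have h2 := h.right
  unfold raceGap
  linarith

theorem RaceInv.of_progress (hp : 0 < p) (hz : 0 < z) (hy : 0 < y₀) {n : ℕ}
    {a' b' a'' b'' : X} (h : RaceInv 𝓐 p s a b z y₀ (n + 1) a' b')
    (hx : raceGap 𝓐 a b a' b' < s) (ha : 𝓐.h a' ≤ 𝓐.h a'') (hb : 𝓐.h b' ≤ 𝓐.h b'')
    (hl : z * (raceGap 𝓐 a b a' b' / p) ≤ raceGap 𝓐 a b a'' b'' - raceGap 𝓐 a b a' b')
    (hu : raceGap 𝓐 a b a'' b'' - raceGap 𝓐 a b a' b' ≤ 2 * (raceGap 𝓐 a b a' b' / p)) :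
    RaceInv 𝓐 p s a b z y₀ n a'' b'' where
  left := by linarith [h.left]
  right := by linarith [h.right]
  le := by
    have : raceGap 𝓐 a b a' b' / p ≤ s / p := by gcongr
    have : s * (1 + 2 / p) = s + 2 * (s / p) := by ring
    linarith
  fuel := by
    have h1 := h.fuel
    have h2 : y₀ ≤ raceGap 𝓐 a b a' b' := by
      have := h.left
      have := h.right
      unfold raceGap
      linarith
    have h3 : y₀ * z / p ≤ z * (raceGap 𝓐 a b a' b' / p) := by
      rw [mul_div_assoc', mul_comm]
      gcongr
    push_cast at h1
    linarith

variable (hG : IsGadget 𝓐 w q z G) (hp : 0 < p) (hz : 0 < z) (hy : 0 < y₀)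
include hG hp hz hy

theorem RaceInv.forall_left {n : ℕ} {a' b' : X}
    (h : RaceInv 𝓐 p s a b z y₀ (n + 1) a' b') (hx : raceGap 𝓐 a b a' b' < s) :
    (G a' (raceGap 𝓐 a b a' b' / p)).Forall fun _ e => RaceInv 𝓐 p s a b z y₀ n e b' := by
  have hε : 0 < raceGap 𝓐 a b a' b' / p := div_pos (h.gap_pos hy) hp
  refine (hG.progress a' _ hε).mono fun l e he => ?_
  have h0 : 0 ≤ z * (raceGap 𝓐 a b a' b' / p) := by positivity
  have h1 : raceGap 𝓐 a b e b' - raceGap 𝓐 a b a' b' = 𝓐.h e - 𝓐.h a' := by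
    unfold raceGap; ring
  exact h.of_progress hp hz hy hx (by linarith) le_rfl (by linarith) (by linarith)

theorem RaceInv.forall_right {n : ℕ} {a' b' : X}
    (h : RaceInv 𝓐 p s a b z y₀ (n + 1) a' b') (hx : raceGap 𝓐 a b a' b' < s) :
    (G b' (raceGap 𝓐 a b a' b' / p)).Forall fun _ e => RaceInv 𝓐 p s a b z y₀ n a' e := by
  have hε : 0 < raceGap 𝓐 a b a' b' / p := div_pos (h.gap_pos hy) hp
  refine (hG.progress b' _ hε).mono fun l e he => ?_
  have h0 : 0 ≤ z * (raceGap 𝓐 a b a' b' / p) := by positivity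
  have h1 : raceGap 𝓐 a b a' e - raceGap 𝓐 a b a' b' = 𝓐.h e - 𝓐.h b' := by
    unfold raceGap; ring
  exact h.of_progress hp hz hy hx le_rfl (by linarith) (by linarith) (by linarith)

/-- Induction principle for races. -/
theorem race_induction {motive : ℕ → X → X → Adversary (X × X) (X × X) → Prop}
    (fin : ∀ n a' b', RaceInv 𝓐 p s a b z y₀ n a' b' → s ≤ raceGap 𝓐 a b a' b' →
      motive n a' b' (req {(a', b), (a, b')} (settle 𝓐 a b a' b')))
    (step : ∀ n a' b' k k', RaceInv 𝓐 p s a b z y₀ (n + 1) a' b' → raceGap 𝓐 a b a' b' < s →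
      0 < raceGap 𝓐 a b a' b' / p →
      ((G a' (raceGap 𝓐 a b a' b' / p)).Forall fun _ e => motive n e b' (k e)) →
      ((G b' (raceGap 𝓐 a b a' b' / p)).Forall fun _ e => motive n a' e (k' e)) →
      motive (n + 1) a' b' (req {(a', b), (a, b')} (flip
        ((G a' (raceGap 𝓐 a b a' b' / p)).graft (offer (fun y => (y, b)) {(a, b')}) k)
        ((G b' (raceGap 𝓐 a b a' b' / p)).graft (offer (fun y => (a, y)) {(a', b)})
          k'))))
    {n : ℕ} {a' b' : X} (h : RaceInv 𝓐 p s a b z y₀ n a' b') :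
    motive n a' b' (race 𝓐 G p s a b n a' b') := by
  induction n generalizing a' b' with
  | zero => exact fin 0 a' b' h (by simpa using h.fuel)
  | succ n ih =>
    rw [race]
    split_ifs with hx
    · exact fin _ a' b' h hx
    · rw [not_le] at hx
      exact step _ a' b' _ _ h hx (div_pos (h.gap_pos hy) hp)
        ((h.forall_left hG hp hz hy hx).mono fun _ _ he => ih he)
        ((h.forall_right hG hp hz hy hx).mono fun _ _ he => ih he)

theorem race_forallReq (hw : 1 ≤ w) {n : ℕ} {a' b' : X}
    (h : RaceInv 𝓐 p s a b z y₀ n a' b') :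
    (race 𝓐 G p s a b n a' b').ForallReq fun r =>
      r.Nonempty ∧ r.card ≤ w + 1 ∧ ∀ y ∈ r, 𝓐.square.h (a, b) ≤ 𝓐.square.h y := by
  have pair : ∀ n a' b', RaceInv 𝓐 p s a b z y₀ n a' b' →
      ({(a', b), (a, b')} : Finset (X × X)).Nonempty ∧
      ({(a', b), (a, b')} : Finset (X × X)).card ≤ w + 1 ∧
      ∀ y ∈ ({(a', b), (a, b')} : Finset (X × X)), 𝓐.square.h (a, b) ≤ 𝓐.square.h y := by
    intro n a' b' h
    have h1 := h.left
    have h2 := h.right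
    refine ⟨by simp, Finset.card_le_two.trans (by omega), ?_⟩
    simp only [Finset.mem_insert, Finset.mem_singleton, forall_eq_or_imp, forall_eq, Arena.square]
    constructor <;> linarith
  refine race_induction hG hp hz hy (motive := fun _ _ _ T => T.ForallReq _) ?_ ?_ h
  · intro n a' b' h _
    refine ⟨pair n a' b' h, ?_⟩
    have h1 := h.left
    have h2 := h.right
    unfold settle
    split_ifs
    · refine ⟨⟨by simp, by simp, ?_⟩, trivial⟩
      simp only [Finset.mem_singleton, forall_eq, Arena.square]
      linarith
    · refine ⟨⟨by simp, by simp, ?_⟩, trivial⟩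
      simp only [Finset.mem_singleton, forall_eq, Arena.square]
      linarith
  · intro n a' b' k k' h hx hε hk hk'
    have h1 := h.left
    have h2 := h.right
    refine ⟨pair (n + 1) a' b' h, forallReq_graft ((hG.forallReq a' _ hε).mono fun r hr => ?_) hk,
      forallReq_graft ((hG.forallReq b' _ hε).mono fun r hr => ?_) hk'⟩
    all_goals
      refine ⟨⟨_, mem_offer.2 (.inr (Finset.mem_singleton_self _))⟩, ?_, ?_⟩
      · refine card_offer_le.trans ?_
        rw [Finset.card_singleton]
        exact Nat.succ_le_succ hr.2.1
      · intro y hy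
        rw [mem_offer, Finset.mem_singleton] at hy
        simp only [Arena.square]
        rcases hy with ⟨y, hy, rfl⟩ | rfl
        · have := hr.2.2 y hy
          dsimp only
          linarith
        · dsimp only
          linarith

theorem race_serves {n : ℕ} {a' b' : X} (h : RaceInv 𝓐 p s a b z y₀ n a' b') :
    (race 𝓐 G p s a b n a' b').Forall fun l e =>
      Serves 𝓐.square.d l (a', b) e (𝓐.square.h e - 𝓐.square.h (a', b)) ∨
      Serves 𝓐.square.d l (a, b') e (𝓐.square.h e - 𝓐.square.h (a, b')) := by
  have hd := 𝓐.square.isMetric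
  refine race_induction hG hp hz hy (motive := fun _ a' b' T => T.Forall fun l e =>
      Serves 𝓐.square.d l (a', b) e (𝓐.square.h e - 𝓐.square.h (a', b)) ∨
      Serves 𝓐.square.d l (a, b') e (𝓐.square.h e - 𝓐.square.h (a, b'))) ?_ ?_ h
  · intro n a' b' h _
    have stay : ∀ x : X × X, Serves 𝓐.square.d [] x x (𝓐.square.h x - 𝓐.square.h x) :=
      fun x => ⟨rfl, by simp⟩
    unfold settle
    split_ifs
    · exact .inl (.cons hd (by simp) (.cons hd (by simp) (stay _)))
    · exact .inr (.cons hd (by simp) (.cons hd (by simp) (stay _)))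
  · intro n a' b' k k' h hx hε hk hk'
    refine ⟨forall_graft.2 (((hG.serves a' _ hε).and hk).mono fun l e he => he.2.mono ?_),
      forall_graft.2 (((hG.serves b' _ hε).and hk').mono fun l e he => he.2.mono ?_)⟩
    · rintro l' e' (h' | h')
      · have h1 := (Serves.image_union (𝓐.square_dist_left b) {(a, b')} he.1).append h'
        refine .inl (.cons hd (by simp) (h1.mono ?_))
        simp only [Arena.square]
        linarith
      · have h1 := (Serves.stay hd (f := fun y => (y, b))
          (Finset.mem_singleton_self (a, b')) l).append h'
        exact .inr (.cons hd (by simp) (h1.mono (by rw [zero_add])))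
    · rintro l' e' (h' | h')
      · have h1 := (Serves.stay hd (f := fun y => (a, y))
          (Finset.mem_singleton_self (a', b)) l).append h'
        exact .inl (.cons hd (by simp) (h1.mono (by rw [zero_add])))
      · have h1 := (Serves.image_union (𝓐.square_dist_right a) {(a', b)} he.1).append h'
        refine .inr (.cons hd (by simp) (h1.mono ?_))
        simp only [Arena.square]
        linarith

theorem race_progress {n : ℕ} {a' b' : X} (h : RaceInv 𝓐 p s a b z y₀ n a' b') :
    (race 𝓐 G p s a b n a' b').Forall fun _ e =>
      y₀ ≤ 𝓐.square.h e - 𝓐.square.h (a, b) ∧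
      𝓐.square.h e - 𝓐.square.h (a, b) ≤ s * (1 + 2 / p) / 2 := by
  refine race_induction hG hp hz hy (motive := fun _ _ _ T => T.Forall _) ?_ ?_ h
  · intro n a' b' h _
    have h1 := h.left
    have h2 := h.right
    have h3 := h.le
    unfold raceGap at h3
    unfold settle
    split_ifs with hab <;> simp only [Adversary.Forall, Arena.square] <;> constructor <;> linarith
  · intro n a' b' k k' h hx hε hk hk'
    exact ⟨forall_graft.2 hk, forall_graft.2 hk'⟩

theorem race_escapeValue {P : ℝ} (hP : s + q ^ 2 / 2 * s ≤ P) (hs : 0 < s)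
    (hq : (1280 * q) ^ 2 = p) {n : ℕ} {a' b' : X} (h : RaceInv 𝓐 p s a b z y₀ n a' b') (y : X × X) :
    q ^ 2 / 2 * (s - raceGap 𝓐 a b a' b') ≤
      (race 𝓐 G p s a b n a' b').escapeValue 𝓐.square.d P y := by
  have hd := 𝓐.square.isMetric
  have hK : 0 ≤ q ^ 2 / 2 := by positivity
  have hP0 : 0 ≤ P := by
    have : 0 ≤ q ^ 2 / 2 * s := by positivity
    linarith
  refine (race_induction hG hp hz hy (motive := fun _ a' b' T => 0 < raceGap 𝓐 a b a' b' ∧ ∀ y,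
    q ^ 2 / 2 * (s - raceGap 𝓐 a b a' b') ≤ T.escapeValue 𝓐.square.d P y) ?_ ?_ h).2 y
  · intro n a' b' h hx
    refine ⟨h.gap_pos hy, fun y => ?_⟩
    have h0 : q ^ 2 / 2 * (s - raceGap 𝓐 a b a' b') ≤ 0 :=
      mul_nonpos_of_nonneg_of_nonpos hK (by linarith)
    have hst : ∀ y, 0 ≤ (settle 𝓐 a b a' b').escapeValue 𝓐.square.d P y := by
      intro y
      unfold settle
      split_ifs <;>
      exact le_escapeValue_req hP0 fun x _ => add_nonneg (hd.nonneg _ _) le_rfl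
    exact h0.trans (le_escapeValue_req hP0 fun x _ => add_nonneg (hd.nonneg _ _) (hst x))
  · intro n a' b' k k' h hx hε hk hk'
    have hx0 := h.gap_pos hy
    have h1 := h.left
    have h2 := h.right
    refine ⟨hx0, fun y => ?_⟩
    set x := raceGap 𝓐 a b a' b' with hxdef
    set ε := x / p with hεdef
    have hpε : p * ε = x := by rw [hεdef]; field_simp
    have hKx : q ^ 2 / 2 * (s - x) ≤ q ^ 2 / 2 * s := by gcongr; linarith
    set Ψ : X → ℝ := fun e => q ^ 2 / 2 * (s - x) + -(q ^ 2 / 2) * (𝓐.h e - 𝓐.h a') with hΨ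
    set Ψ' : X → ℝ := fun e => q ^ 2 / 2 * (s - x) + -(q ^ 2 / 2) * (𝓐.h e - 𝓐.h b') with hΨ'
    have hprop : ∀ {v e : X}, (z * ε ≤ 𝓐.h e - 𝓐.h v ∧ 𝓐.h e - 𝓐.h v ≤ 2 * ε) →
        q ^ 2 / 2 * (s - x) + -(q ^ 2 / 2) * (𝓐.h e - 𝓐.h v) ≤ q ^ 2 / 2 * s := by
      intro v e he
      have : 0 ≤ q ^ 2 / 2 * (𝓐.h e - 𝓐.h v) :=
        mul_nonneg hK (le_trans (by positivity) he.1)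
      linarith
    have hk1 : (G a' ε).Forall fun _ e => Ψ e ≤ P ∧ p * ε + Ψ e ≤ P ∧
        ∀ y, Ψ e ≤ (k e).escapeValue 𝓐.square.d P y := by
      refine (hk.and (hG.progress a' ε hε)).mono fun l e he => ?_
      have h3 := hprop he.2
      refine ⟨by simp only [hΨ]; linarith, by simp only [hΨ]; linarith, fun y => ?_⟩
      refine le_trans (le_of_eq ?_) (he.1.2 y)
      simp only [hΨ, hxdef, raceGap]
      ring
    have hk2 : (G b' ε).Forall fun _ e => Ψ' e ≤ P ∧ p * ε + Ψ' e ≤ P ∧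
        ∀ y, Ψ' e ≤ (k' e).escapeValue 𝓐.square.d P y := by
      refine (hk'.and (hG.progress b' ε hε)).mono fun l e he => ?_
      have h3 := hprop he.2
      refine ⟨by simp only [hΨ']; linarith, by simp only [hΨ']; linarith, fun y => ?_⟩
      refine le_trans (le_of_eq ?_) (he.1.2 y)
      simp only [hΨ', hxdef, raceGap]
      ring
    have hE1 : q ^ 2 / 2 * (s - x) - q ^ 2 / 2 * ε ≤ (G a' ε).expect fun _ e => Ψ e := by
      rw [hΨ, expect_affine]
      have := mul_le_mul_of_nonneg_left (hG.expect_le a' ε hε) hK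
      linarith
    have hE2 : q ^ 2 / 2 * (s - x) - q ^ 2 / 2 * ε ≤ (G b' ε).expect fun _ e => Ψ' e := by
      rw [hΨ', expect_affine]
      have := mul_le_mul_of_nonneg_left (hG.expect_le b' ε hε) hK
      linarith
    refine le_escapeValue_req (by linarith) fun y' hy' => ?_
    have hdy := hd.nonneg y y'
    rw [Finset.mem_insert, Finset.mem_singleton] at hy'
    have hv := hG.le_escapeValue a' ε hε
    have hv' := hG.le_escapeValue b' ε hε
    rw [hq] at hv hv'
    rw [escapeValue]
    rcases hy' with rfl | rfl
    · have hL := escapeValue_add_le_graft hd.nonneg (S := {y | 𝓐.h a' ≤ 𝓐.h y})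
        (𝓐.square_dist_left b) (O := {(a, b')}) (P := p * ε) (x := a') (fun y hy o ho => ?_)
        ((hG.forallReq a' ε hε).mono fun r hr => hr.2.2) hk1 (le_refl (𝓐.h a'))
      · have hR := le_escapeValue_graft hd.nonneg (φ := offer (fun y => (a, y)) {(a', b)})
          (hk2.mono fun l e he => ⟨he.1, he.2.2⟩) (a', b)
        linarith
      · rw [Finset.mem_singleton.1 ho, hpε]
        have h3 := 𝓐.height_sub_le y a
        have h4 := 𝓐.height_sub_le b' b
        rw [𝓐.isMetric.2.1 b' b] at h4
        simp only [Arena.square]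
        have h5 : 𝓐.h a' ≤ 𝓐.h y := hy
        simp only [hxdef, raceGap]
        linarith
    · have hR := escapeValue_add_le_graft hd.nonneg (S := {y | 𝓐.h b' ≤ 𝓐.h y})
        (𝓐.square_dist_right a) (O := {(a', b)}) (P := p * ε) (x := b') (fun y hy o ho => ?_)
        ((hG.forallReq b' ε hε).mono fun r hr => hr.2.2) hk2 (le_refl (𝓐.h b'))
      · have hL := le_escapeValue_graft hd.nonneg (φ := offer (fun y => (y, b)) {(a, b')})
          (hk1.mono fun l e he => ⟨he.1, he.2.2⟩) (a, b')
        linarith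
      · rw [Finset.mem_singleton.1 ho, hpε]
        have h3 := 𝓐.height_sub_le y b
        have h4 := 𝓐.height_sub_le a' a
        rw [𝓐.isMetric.2.1 a' a] at h4
        simp only [Arena.square]
        have h5 : 𝓐.h b' ≤ 𝓐.h y := hy
        simp only [hxdef, raceGap]
        linarith

theorem race_le_expect (hs : 0 < s) {n : ℕ} {a' b' : X} (h : RaceInv 𝓐 p s a b z y₀ n a' b') :
    (s - s / 4 - (((𝓐.h a' - 𝓐.h a) - (𝓐.h b' - 𝓐.h b)) ^ 2 / s +
      2 / p * (s * (1 + 2 / p) - raceGap 𝓐 a b a' b'))) / 2 ≤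
      (race 𝓐 G p s a b n a' b').expect fun _ e => 𝓐.square.h e - 𝓐.square.h (a, b) := by
  refine race_induction hG hp hz hy (motive := fun _ a' b' T =>
    (s - s / 4 - (((𝓐.h a' - 𝓐.h a) - (𝓐.h b' - 𝓐.h b)) ^ 2 / s +
      2 / p * (s * (1 + 2 / p) - raceGap 𝓐 a b a' b'))) / 2 ≤
      T.expect fun _ e => 𝓐.square.h e - 𝓐.square.h (a, b)) ?_ ?_ h
  · intro n a' b' h hx
    have h0 : 0 ≤ 2 / p * (s * (1 + 2 / p) - raceGap 𝓐 a b a' b') :=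
      mul_nonneg (by positivity) (by linarith [h.le])
    have key : ∀ D : ℝ, |D| ≤ s / 4 + D ^ 2 / s := by
      intro D
      have : s / 4 + D ^ 2 / s - |D| = (s / 2 - |D|) ^ 2 / s := by
        rw [← sq_abs D]
        field_simp
        ring
      have : 0 ≤ (s / 2 - |D|) ^ 2 / s := by positivity
      linarith
    have h1 := key ((𝓐.h a' - 𝓐.h a) - (𝓐.h b' - 𝓐.h b))
    unfold raceGap at *
    unfold settle
    split_ifs with hab <;> simp only [expect, Arena.square]
    · rw [abs_of_nonpos (by linarith)] at h1
      linarith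
    · rw [abs_of_nonneg (by linarith)] at h1
      linarith
  · intro n a' b' k k' h hx hε hk hk'
    set x := raceGap 𝓐 a b a' b' with hxdef
    set ε := x / p with hεdef
    set D := (𝓐.h a' - 𝓐.h a) - (𝓐.h b' - 𝓐.h b) with hD
    set c := (s - s / 4 - (D ^ 2 / s + 2 / p * (s * (1 + 2 / p) - x))) / 2 with hc
    have key : ∀ D' Δ : ℝ, 0 ≤ Δ → Δ ≤ 2 * ε → D' ^ 2 = D ^ 2 →
        c + -(D' / s) * Δ ≤
          (s - s / 4 - ((D' + Δ) ^ 2 / s + 2 / p * (s * (1 + 2 / p) - (x + Δ)))) / 2 := by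
      intro D' Δ h1 h2 h3
      have h4 : Δ ≤ 2 * (s / p) := h2.trans (by rw [hεdef]; gcongr)
      have h5 : Δ * Δ ≤ 2 * (s / p) * Δ := mul_le_mul_of_nonneg_right h4 h1
      have h6 : Δ * Δ / s ≤ 2 / p * Δ := by
        rw [div_le_iff₀ hs]
        refine h5.trans_eq ?_
        ring
      rw [hc, ← h3]
      have h7 : (D' + Δ) ^ 2 / s = D' ^ 2 / s + 2 * (D' / s * Δ) + Δ * Δ / s := by ring
      rw [h7]
      linarith
    have e1 := expect_mono (T := G a' ε) (f := fun _ e => c + -(D / s) * (𝓐.h e - 𝓐.h a'))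
      (g := fun _ e => (k e).expect fun _ e => 𝓐.square.h e - 𝓐.square.h (a, b))
      ((hk.and (hG.progress a' ε hε)).mono fun l e he => by
        refine (key D _ (le_trans (by positivity) he.2.1) he.2.2 rfl).trans
          (le_trans (le_of_eq ?_) he.1)
        simp only [hD, hxdef, raceGap]
        ring)
    have e2 := expect_mono (T := G b' ε) (f := fun _ e => c + -(-D / s) * (𝓐.h e - 𝓐.h b'))
      (g := fun _ e => (k' e).expect fun _ e => 𝓐.square.h e - 𝓐.square.h (a, b))
      ((hk'.and (hG.progress b' ε hε)).mono fun l e he => by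
        refine (key (-D) _ (le_trans (by positivity) he.2.1) he.2.2 (neg_sq D)).trans
          (le_trans (le_of_eq ?_) he.1)
        simp only [hD, hxdef, raceGap]
        ring)
    rw [expect_affine] at e1 e2
    have e3 := hG.expect_eq a' b' ε hε id
    simp only [id] at e3
    rw [e3] at e1
    rw [neg_div] at e2
    simp only [expect, expect_graft]
    linarith

omit hy in
theorem exists_race_expect_eq (f : ℝ → ℝ) (n : ℕ) : ∃ Φ : ℝ → ℝ → ℝ, ∀ a b a' b' : X,
    0 < raceGap 𝓐 a b a' b' →
    (race 𝓐 G p s a b n a' b').expect (fun _ e => f (𝓐.square.h e - 𝓐.square.h (a, b))) =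
      Φ (𝓐.h a' - 𝓐.h a) (𝓐.h b' - 𝓐.h b) := by
  have hset : ∀ a b a' b' : X,
      (settle 𝓐 a b a' b').expect (fun _ e => f (𝓐.square.h e - 𝓐.square.h (a, b))) =
      f (min (𝓐.h a' - 𝓐.h a) (𝓐.h b' - 𝓐.h b)) := by
    intro a b a' b'
    unfold settle
    split_ifs with hab <;> simp only [expect, Arena.square]
    · rw [min_eq_left hab]
      ring_nf
    · rw [min_eq_right (not_le.1 hab).le]
      ring_nf
  induction n with
  | zero => exact ⟨fun L R => f (min L R), fun a b a' b' _ => hset a b a' b'⟩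
  | succ n ih =>
    obtain ⟨Φ, hΦ⟩ := ih
    refine ⟨fun L R => if s ≤ L + R then f (min L R) else
      ((G 𝓐.base ((L + R) / p)).expect (fun _ e => Φ (L + (𝓐.h e - 𝓐.h 𝓐.base)) R) +
      (G 𝓐.base ((L + R) / p)).expect (fun _ e => Φ L (R + (𝓐.h e - 𝓐.h 𝓐.base)))) / 2,
      fun a b a' b' h => ?_⟩
    have hε : 0 < raceGap 𝓐 a b a' b' / p := div_pos h hp
    rw [race]
    change _ = if s ≤ raceGap 𝓐 a b a' b' then _ else _
    rw [expect]
    split_ifs with hx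
    · exact hset a b a' b'
    · simp only [expect, expect_graft]
      congr 2
      · refine Eq.trans ?_ (hG.expect_eq a' 𝓐.base _ hε
          fun t => Φ (𝓐.h a' - 𝓐.h a + t) (𝓐.h b' - 𝓐.h b))
        refine expect_congr ((hG.progress a' _ hε).mono fun l e he => ?_)
        have h0 : 0 ≤ 𝓐.h e - 𝓐.h a' := le_trans (by positivity) he.1
        rw [hΦ _ _ _ _ (by unfold raceGap at *; linarith)]
        ring_nf
      · refine Eq.trans ?_ (hG.expect_eq b' 𝓐.base _ hε
          fun t => Φ (𝓐.h a' - 𝓐.h a) (𝓐.h b' - 𝓐.h b + t))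
        refine expect_congr ((hG.progress b' _ hε).mono fun l e he => ?_)
        have h0 : 0 ≤ 𝓐.h e - 𝓐.h b' := le_trans (by positivity) he.1
        rw [hΦ _ _ _ _ (by unfold raceGap at *; linarith)]
        ring_nf

omit hG hp hz hy in
variable (𝓐 G p s) in
/-- The damping factor of the characteristic function of the lead of the first racer, at frequency
`m / s`, in a race with at most `n` rounds to go and total progress `x`. -/
noncomputable def raceDamping (m : ℝ) : ℕ → ℝ → ℝ
  | 0, _ => 1
  | n + 1, x => if s ≤ x then 1 else (G 𝓐.base (x / p)).expect fun _ e =>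
      raceDamping m n (x + (𝓐.h e - 𝓐.h 𝓐.base)) * Real.cos (m * (𝓐.h e - 𝓐.h 𝓐.base) / s)

theorem raceDamping_mem {m : ℝ} (hm : 2 ≤ m) (hpm : m ^ 2 = p) (hs : 0 < s) {n : ℕ} {x : ℝ}
    (hx : y₀ ≤ x) (hn : s ≤ x + n * (y₀ * z / p)) :
    0 ≤ raceDamping 𝓐 G p s m n x ∧
      raceDamping 𝓐 G p s m n x ≤ max (1 - 1 / 160) (1 - 1 / 40 * (1 - x / s)) := by
  induction n generalizing x with
  | zero =>
    have h1 : 1 ≤ x / s := by rw [le_div_iff₀ hs]; simpa using hn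
    exact ⟨zero_le_one, le_max_of_le_right (by simp only [raceDamping]; linarith)⟩
  | succ n ih =>
    rw [raceDamping]
    split_ifs with hxs
    · have h1 : 1 ≤ x / s := by rwa [le_div_iff₀ hs, one_mul]
      exact ⟨zero_le_one, le_max_of_le_right (by linarith)⟩
    rw [not_le] at hxs
    have hx0 : 0 < x := hy.trans_le hx
    have hε : 0 < x / p := div_pos hx0 hp
    set ε := x / p with hεdef
    have hp4 : 4 ≤ p := by rw [← hpm]; nlinarith
    have hεx : ε ≤ x / 4 := by rw [hεdef]; gcongr
    have hmx : m ^ 2 * ε = x := by rw [hpm, hεdef]; field_simp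
    have hall : (G 𝓐.base ε).Forall fun _ e => 0 ≤ 𝓐.h e - 𝓐.h 𝓐.base ∧
        𝓐.h e - 𝓐.h 𝓐.base ≤ 2 * ε ∧
        0 ≤ raceDamping 𝓐 G p s m n (x + (𝓐.h e - 𝓐.h 𝓐.base)) ∧
        raceDamping 𝓐 G p s m n (x + (𝓐.h e - 𝓐.h 𝓐.base)) ≤
          max (1 - 1 / 160) (1 - 1 / 40 * (1 - (x + (𝓐.h e - 𝓐.h 𝓐.base)) / s)) ∧
        0 ≤ Real.cos (m * (𝓐.h e - 𝓐.h 𝓐.base) / s) ∧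
        Real.cos (m * (𝓐.h e - 𝓐.h 𝓐.base) / s) ≤
          1 - 1 / 5 * (m * (𝓐.h e - 𝓐.h 𝓐.base) / s) ^ 2 := by
      refine (hG.progress 𝓐.base ε hε).mono fun l e he => ?_
      have h0 : 0 ≤ 𝓐.h e - 𝓐.h 𝓐.base := le_trans (by positivity) he.1
      set Δ := 𝓐.h e - 𝓐.h 𝓐.base
      have h1 := ih (x := x + Δ) (by linarith) (by
        have h3 : y₀ * z / p ≤ z * ε := by
          rw [hεdef, mul_div_assoc', mul_comm]
          gcongr
        push_cast at hn
        linarith [he.1])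
      have hu : m * Δ / s ≤ 1 := by
        rw [div_le_one hs]
        have h5 : m * Δ ≤ m * (2 * ε) := by gcongr; exact he.2
        have h6 : m * (2 * ε) ≤ m * (m * ε) := by gcongr
        nlinarith
      have hu0 : 0 ≤ m * Δ / s := by positivity
      have hu1 : |m * Δ / s| ≤ 1 := by rwa [abs_of_nonneg hu0]
      refine ⟨h0, he.2, h1.1, h1.2, (Real.cos_pos_of_le_one hu1).le, ?_⟩
      refine (Real.cos_le_one_sub_mul_cos_sq (hu1.trans (by linarith [Real.pi_gt_three]))).trans ?_
      have h7 : (1 : ℝ) / 5 ≤ 2 / Real.pi ^ 2 := by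
        rw [div_le_div_iff₀ (by norm_num) (by positivity)]
        nlinarith [Real.pi_lt_d2, Real.pi_pos]
      have := mul_le_mul_of_nonneg_right h7 (sq_nonneg (m * Δ / s))
      linarith
    refine ⟨?_, ?_⟩
    · refine (expect_const (G 𝓐.base ε) 0).symm.trans_le (expect_mono (hall.mono fun l e he => ?_))
      exact mul_nonneg he.2.2.1 he.2.2.2.2.1
    rcases le_or_gt x (s / 2) with hxh | hxh
    · refine le_max_of_le_left ((expect_mono (hall.mono fun l e he => ?_)).trans_eq
        (expect_const (G 𝓐.base ε) _))
      obtain ⟨h1, h2, h3, h4, h5, h6⟩ := he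
      have h7 : (x + (𝓐.h e - 𝓐.h 𝓐.base)) / s ≤ 3 / 4 := by
        rw [div_le_iff₀ hs]
        linarith
      rw [max_eq_left (by linarith)] at h4
      exact (mul_le_of_le_one_right h3 (Real.cos_le_one _)).trans h4
    · set β := max (1 - 1 / 160) (1 - 1 / 40 * (1 - x / s)) with hβ
      have hβ1 : 1 / 2 ≤ β := le_max_of_le_left (by norm_num)
      have hκ : 1 / (20 * s) ≤ x / (10 * s ^ 2) := by
        rw [div_le_div_iff₀ (by positivity) (by positivity)]
        nlinarith
      set κ := x / (10 * s ^ 2) with hκdef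
      have hE := hG.le_expect 𝓐.base ε hε
      have h40 : 1 / (40 * s) = 1 / (20 * s) / 2 := by
        field_simp
        norm_num
      have hle := expect_mono (T := G 𝓐.base ε)
        (f := fun _ e => raceDamping 𝓐 G p s m n (x + (𝓐.h e - 𝓐.h 𝓐.base)) *
          Real.cos (m * (𝓐.h e - 𝓐.h 𝓐.base) / s))
        (g := fun _ e => (β + κ * ε / 4) +
        (1 / (40 * s) - κ) * (𝓐.h e - 𝓐.h 𝓐.base)) (hall.mono fun l e he => by
        obtain ⟨h1, h2, h3, h4, h5, h6⟩ := he
        set Δ := 𝓐.h e - 𝓐.h 𝓐.base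
        have h7 : max (1 - 1 / 160) (1 - 1 / 40 * (1 - (x + Δ) / s)) ≤ β + 1 / (40 * s) * Δ := by
          have h8 : 1 / (40 * s) * Δ = 1 / 40 * (Δ / s) := by field_simp
          have h9 : 0 ≤ Δ / s := by positivity
          rw [h8, add_div]
          refine max_le ?_ ?_
          · have := le_max_left (1 - 1 / 160) (1 - 1 / 40 * (1 - x / s))
            linarith
          · have := le_max_right (1 - 1 / 160) (1 - 1 / 40 * (1 - x / s))
            linarith
        have h10 : κ * (Δ - ε / 4) ≤ 1 / 10 * (m * Δ / s) ^ 2 := by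
          have h11 : (m * Δ / s) ^ 2 = m ^ 2 * Δ ^ 2 / s ^ 2 := by ring
          have h12 : κ * (Δ - ε / 4) = 1 / 10 * (m ^ 2 * (ε * (Δ - ε / 4)) / s ^ 2) := by
            rw [hκdef, ← hmx]
            field_simp
          rw [h11, h12]
          gcongr
          nlinarith [sq_nonneg (Δ - ε / 2)]
        have h13 : 0 ≤ 1 / (40 * s) * Δ := by positivity
        have h14 : 0 ≤ (m * Δ / s) ^ 2 := sq_nonneg _
        have h15 : raceDamping 𝓐 G p s m n (x + Δ) * Real.cos (m * Δ / s) ≤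
            (β + 1 / (40 * s) * Δ) * (1 - 1 / 5 * (m * Δ / s) ^ 2) :=
          mul_le_mul (h4.trans h7) h6 h5 (by linarith)
        nlinarith [mul_nonneg h13 h14, mul_nonneg (sub_nonneg.2 hβ1) h14])
      rw [expect_affine] at hle
      have h16 : (1 / (40 * s) - κ) * (G 𝓐.base ε).expect (fun _ e => 𝓐.h e - 𝓐.h 𝓐.base) ≤
          (1 / (40 * s) - κ) * (ε / 2) := by
        refine mul_le_mul_of_nonpos_left hE ?_
        have : 0 < 1 / (20 * s) := by positivity
        linarith
      have h17 : 1 / (20 * s) * ε ≤ κ * ε := by gcongr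
      rw [h40] at h16 hle
      linarith

theorem race_expect_le {m : ℝ} (hm : 0 < m) (hs : 0 < s) {n : ℕ} {a' b' : X}
    (h : RaceInv 𝓐 p s a b z y₀ n a' b') :
    (race 𝓐 G p s a b n a' b').expect (fun _ e => 𝓐.square.h e - 𝓐.square.h (a, b)) ≤
      s * (1 + 2 / p) / 2 - s / (2 * m) *
        (1 - Real.cos (m * ((𝓐.h a' - 𝓐.h a) - (𝓐.h b' - 𝓐.h b)) / s) *
          raceDamping 𝓐 G p s m n (raceGap 𝓐 a b a' b')) := by
  have hfin : ∀ a' b', raceGap 𝓐 a b a' b' ≤ s * (1 + 2 / p) →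
      (settle 𝓐 a b a' b').expect (fun _ e => 𝓐.square.h e - 𝓐.square.h (a, b)) ≤
      s * (1 + 2 / p) / 2 - s / (2 * m) *
        (1 - Real.cos (m * ((𝓐.h a' - 𝓐.h a) - (𝓐.h b' - 𝓐.h b)) / s) * 1) := by
    intro a' b' h
    have key : ∀ D : ℝ, s / (2 * m) * (1 - Real.cos (m * D / s) * 1) ≤ |D| / 2 := by
      intro D
      have h1 : 1 - Real.cos (m * D / s) ≤ |m * D / s| := by
        rcases le_or_gt |m * D / s| 2 with h2 | h2
        · have h3 := Real.one_sub_sq_div_two_le_cos (x := m * D / s)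
          rw [← sq_abs] at h3
          nlinarith [abs_nonneg (m * D / s)]
        · linarith [Real.neg_one_le_cos (m * D / s)]
      have h2 : |D| / 2 = s / (2 * m) * |m * D / s| := by
        rw [abs_div, abs_mul, abs_of_pos hm, abs_of_pos hs]
        field_simp
      rw [h2, mul_one]
      gcongr
    have h1 := key ((𝓐.h a' - 𝓐.h a) - (𝓐.h b' - 𝓐.h b))
    unfold raceGap at h
    unfold settle
    split_ifs with hab <;> simp only [expect, Arena.square]
    · rw [abs_of_nonpos (by linarith)] at h1
      linarith
    · rw [abs_of_nonneg (by linarith)] at h1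
      linarith
  refine race_induction hG hp hz hy (motive := fun n a' b' T =>
    T.expect (fun _ e => 𝓐.square.h e - 𝓐.square.h (a, b)) ≤
      s * (1 + 2 / p) / 2 - s / (2 * m) *
        (1 - Real.cos (m * ((𝓐.h a' - 𝓐.h a) - (𝓐.h b' - 𝓐.h b)) / s) *
          raceDamping 𝓐 G p s m n (raceGap 𝓐 a b a' b'))) ?_ ?_ h
  · intro n a' b' h hx
    have h1 : raceDamping 𝓐 G p s m n (raceGap 𝓐 a b a' b') = 1 := by
      cases n <;> simp [raceDamping, hx]
    rw [h1]
    exact hfin a' b' h.le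
  · intro n a' b' k k' h hx hε hk hk'
    set x := raceGap 𝓐 a b a' b' with hxdef
    set ε := x / p with hεdef
    set D := (𝓐.h a' - 𝓐.h a) - (𝓐.h b' - 𝓐.h b) with hD
    set K := s * (1 + 2 / p) / 2 with hK
    set Ψ : ℝ → ℝ → ℝ := fun D Δ => K - s / (2 * m) *
      (1 - Real.cos (m * D / s) * raceDamping 𝓐 G p s m n (x + Δ)) with hΨ
    have e1 := expect_mono (T := G a' ε)
      (f := fun _ e => (k e).expect fun _ e => 𝓐.square.h e - 𝓐.square.h (a, b))
      (g := fun _ e => Ψ (D + (𝓐.h e - 𝓐.h a')) (𝓐.h e - 𝓐.h a'))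
      (hk.mono fun l e he => by
        refine he.trans (le_of_eq ?_)
        simp only [hΨ, hD, hxdef, raceGap]
        ring_nf)
    have e2 := expect_mono (T := G b' ε)
      (f := fun _ e => (k' e).expect fun _ e => 𝓐.square.h e - 𝓐.square.h (a, b))
      (g := fun _ e => Ψ (D - (𝓐.h e - 𝓐.h b')) (𝓐.h e - 𝓐.h b'))
      (hk'.mono fun l e he => by
        refine he.trans (le_of_eq ?_)
        simp only [hΨ, hD, hxdef, raceGap]
        ring_nf)
    rw [hG.expect_eq a' 𝓐.base ε hε fun t => Ψ (D + t) t] at e1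
    rw [hG.expect_eq b' 𝓐.base ε hε fun t => Ψ (D - t) t] at e2
    have e3 := expect_add (G 𝓐.base ε)
      (fun _ e => Ψ (D + (𝓐.h e - 𝓐.h 𝓐.base)) (𝓐.h e - 𝓐.h 𝓐.base))
      (fun _ e => Ψ (D - (𝓐.h e - 𝓐.h 𝓐.base)) (𝓐.h e - 𝓐.h 𝓐.base))
    have e4 := expect_affine (G 𝓐.base ε) (2 * (K - s / (2 * m)))
      (2 * (s / (2 * m) * Real.cos (m * D / s)))
      (fun _ e => raceDamping 𝓐 G p s m n (x + (𝓐.h e - 𝓐.h 𝓐.base)) *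
        Real.cos (m * (𝓐.h e - 𝓐.h 𝓐.base) / s))
    have e5 : ∀ t, Ψ (D + t) t + Ψ (D - t) t = 2 * (K - s / (2 * m)) +
        2 * (s / (2 * m) * Real.cos (m * D / s)) *
        (raceDamping 𝓐 G p s m n (x + t) * Real.cos (m * t / s)) := by
      intro t
      simp only [hΨ, mul_add, mul_sub, add_div, sub_div, Real.cos_add, Real.cos_sub]
      ring
    simp only [e5] at e3
    rw [e4] at e3
    have e6 : raceDamping 𝓐 G p s m (n + 1) x = (G 𝓐.base ε).expect fun _ e =>
      raceDamping 𝓐 G p s m n (x + (𝓐.h e - 𝓐.h 𝓐.base)) *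
        Real.cos (m * (𝓐.h e - 𝓐.h 𝓐.base) / s) := by
      rw [raceDamping, if_neg (not_le.2 hx)]
    rw [e6]
    simp only [expect, expect_graft]
    linarith

end Race

theorem Adversary.forall_of_forall {M F : Type} (T : Adversary M F)
    {Q : List (Finset M) → F → Prop} (h : ∀ l e, Q l e) : T.Forall Q := by
  induction T generalizing Q with
  | done e => exact h _ _
  | req r n ih => exact ih fun l e => h _ _
  | flip a b iha ihb => exact ⟨iha h, ihb h⟩

theorem Serves.of_dist {M : Type} {d : M → M → ℝ} (hd : IsMetric d) {l : List (Finset M)}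
    {x y e : M} {c : ℝ} (h : Serves d l y e c) (hl : l ≠ []) : Serves d l x e (d x y + c) := by
  cases l with
  | nil => exact absurd rfl hl
  | cons r l =>
    obtain ⟨u, hu, h⟩ := h
    exact ⟨u, hu, h.mono (by linarith [hd.2.2 x y u])⟩

theorem race_ne_nil {X : Type} (𝓐 : Arena X) (G : X → ℝ → Adversary X X) (p s : ℝ) (a b : X)
    (n : ℕ) (a' b' : X) : (race 𝓐 G p s a b n a' b').Forall fun l _ => l ≠ [] := by
  cases n <;> simp only [race, Adversary.Forall] <;>
    exact forall_of_forall _ fun l e => List.cons_ne_nil _ _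

theorem IsGadget.exists_square {X : Type} {𝓐 : Arena X} {w : ℕ} {q z : ℝ}
    {G : X → ℝ → Adversary X X} (hG : IsGadget 𝓐 w q z G) (hw : 1 ≤ w) (hq : 1 ≤ q)
    (hz : 0 < z) :
    ∃ z' G', 0 < z' ∧ IsGadget 𝓐.square (w + 1) (q + 1 / 1228800) z' G' := by
  obtain ⟨m, hm⟩ : ∃ m, m = 1280 * q := ⟨_, rfl⟩
  obtain ⟨p, hp⟩ : ∃ p, p = m ^ 2 := ⟨_, rfl⟩
  obtain ⟨t, ht⟩ : ∃ t, t = 1 / (640 * m) := ⟨_, rfl⟩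
  obtain ⟨μ, hμ⟩ : ∃ μ, μ = (1 - 3 * t) / 2 := ⟨_, rfl⟩
  have hm1 : 1280 ≤ m := by linarith
  have hm0 : 0 < m := by linarith
  have hp1 : 1280 ≤ p := by rw [hp]; nlinarith
  have hp0 : 0 < p := by linarith
  have ht0 : 0 < t := by rw [ht]; positivity
  have ht1 : t ≤ 1 / 100 := by
    rw [ht, div_le_div_iff₀ (by positivity) (by norm_num)]
    linarith
  have hμ0 : 0 < μ := by rw [hμ]; linarith
  have h2p : 2 / p ≤ t := by
    rw [ht, hp, div_le_div_iff₀ (by positivity) (by positivity)]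
    nlinarith
  obtain ⟨n, hn⟩ : ∃ n : ℕ, 1280 * m * p / z ≤ n := exists_nat_ge _
  have hscale : ∀ s : ℝ, 0 < s → 0 < s / μ ∧ 2 * s ≤ s / μ ∧ s / μ ≤ 3 * s ∧ s / μ * μ = s := by
    intro s hs
    refine ⟨by positivity, ?_, ?_, div_mul_cancel₀ _ hμ0.ne'⟩
    · rw [le_div_iff₀ hμ0]
      nlinarith
    · rw [div_le_iff₀ hμ0]
      nlinarith
  have hy : ∀ s : ℝ, 0 < s → 0 < t * (s / μ) / 2 := by
    intro s hs
    have := (hscale s hs).1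
    positivity
  have hgap : ∀ (v : X × X) (s : ℝ), raceGap 𝓐 v.1 v.2 (𝓐.up v.1 (t * (s / μ) / 2))
      (𝓐.up v.2 (t * (s / μ) / 2)) = t * (s / μ) := by
    intro v s
    simp only [raceGap, 𝓐.height_up]
    ring
  have hinv : ∀ (v : X × X) (s : ℝ), 0 < s → RaceInv 𝓐 p (s / μ) v.1 v.2 z (t * (s / μ) / 2) n
      (𝓐.up v.1 (t * (s / μ) / 2)) (𝓐.up v.2 (t * (s / μ) / 2)) := by
    intro v s hs
    have hS := (hscale s hs).1
    have hy0 := hy s hs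
    refine ⟨by rw [𝓐.height_up]; linarith, by rw [𝓐.height_up]; linarith, ?_, ?_⟩
    · rw [hgap, mul_comm]
      have : 0 < 2 / p := by positivity
      exact mul_le_mul_of_nonneg_left (by linarith) hS.le
    · rw [hgap]
      have h1 : s / μ = 1280 * m * p / z * (t * (s / μ) / 2 * z / p) := by
        rw [ht]
        field_simp
        norm_num
      have h2 : 1280 * m * p / z * (t * (s / μ) / 2 * z / p) ≤ n * (t * (s / μ) / 2 * z / p) := by
        gcongr
      have h3 : 0 < t * (s / μ) := by positivity
      linarith
  have hstart : ∀ (v : X × X) (s : ℝ), 0 < s →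
      (𝓐.square.d v (𝓐.up v.1 (t * (s / μ) / 2), v.2) = t * (s / μ) / 2 ∧
      𝓐.square.h (𝓐.up v.1 (t * (s / μ) / 2), v.2) = 𝓐.square.h v + t * (s / μ) / 2) ∧
      (𝓐.square.d v (v.1, 𝓐.up v.2 (t * (s / μ) / 2)) = t * (s / μ) / 2 ∧
      𝓐.square.h (v.1, 𝓐.up v.2 (t * (s / μ) / 2)) = 𝓐.square.h v + t * (s / μ) / 2) := by
    intro v s hs
    have hy0 := hy s hs
    simp only [Arena.square, 𝓐.dist_up _ _ hy0.le, 𝓐.height_up, (𝓐.isMetric.1 _ _).2]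
    refine ⟨⟨by ring, by ring⟩, by ring, by ring⟩
  refine ⟨t / 2, fun v s => race 𝓐 G p (s / μ) v.1 v.2 n (𝓐.up v.1 (t * (s / μ) / 2))
    (𝓐.up v.2 (t * (s / μ) / 2)), by positivity, ?_⟩
  constructor
  · intro v s hs
    exact race_forallReq hG hp0 hz (hy s hs) hw (hinv v s hs)
  · intro v s hs
    have hd := 𝓐.square.isMetric
    obtain ⟨⟨h1, h2⟩, h3, h4⟩ := hstart v s hs
    refine ((race_serves hG hp0 hz (hy s hs) (hinv v s hs)).and
      (race_ne_nil _ _ _ _ _ _ _ _ _)).mono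
      fun l e he => ?_
    rcases he with ⟨he | he, hl⟩
    · exact (Serves.of_dist hd (x := v) he hl).mono (by linarith)
    · exact (Serves.of_dist hd (x := v) he hl).mono (by linarith)
  · intro v s hs
    obtain ⟨h1, h2, h3, h4⟩ := hscale s hs
    refine (race_progress hG hp0 hz (hy s hs) (hinv v s hs)).mono fun l e he => ⟨?_, ?_⟩
    · refine le_trans ?_ he.1
      nlinarith
    · refine he.2.trans ?_
      nlinarith
  · intro v s hs
    obtain ⟨h1, h2, h3, h4⟩ := hscale s hs
    have h5 := race_expect_le hG hp0 hz (hy s hs) hm0 h1 (hinv v s hs)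
    have h6 := (raceDamping_mem hG hp0 hz (hy s hs) (m := m) (n := n) (x := t * (s / μ))
      (by linarith) hp.symm h1 (by linarith [hy s hs]) (by
        have := (hinv v s hs).fuel
        rwa [hgap] at this)).2
    rw [hgap] at h5
    have h7 : t * (s / μ) / (s / μ) = t := by field_simp
    rw [h7, max_eq_left (by linarith)] at h6
    simp only [𝓐.height_up, add_sub_cancel_left, sub_self, mul_zero, zero_div, Real.cos_zero,
      one_mul] at h5
    have h8 : s / μ / (2 * m) * (1 / 160) ≤ s / μ / (2 * m) *
        (1 - raceDamping 𝓐 G p (s / μ) m n (t * (s / μ))) := by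
      gcongr
      linarith
    have h9 : s / μ / (2 * m) * (1 / 160) = s / μ * (2 * t) := by
      rw [ht]
      field_simp
      norm_num
    have h10 : s / μ * (1 + 2 / p) ≤ s / μ * (1 + t) := by gcongr
    have h11 : s / μ * μ = s / μ * (1 - 3 * t) / 2 := by rw [hμ]; ring
    linarith
  · intro v s hs
    obtain ⟨h1, h2, h3, h4⟩ := hscale s hs
    refine le_trans ?_ (race_le_expect hG hp0 hz (hy s hs) h1 (hinv v s hs))
    rw [hgap]
    simp only [𝓐.height_up, add_sub_cancel_left, sub_self, ne_eq, OfNat.ofNat_ne_zero,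
      not_false_eq_true, zero_pow, zero_div, zero_add]
    have h5 : 2 / p * (s / μ * (1 + 2 / p) - t * (s / μ)) ≤ 1 / 100 * (s / μ * 2) := by
      have h0 : 0 ≤ 2 / p := by positivity
      refine mul_le_mul (by linarith) (by nlinarith) ?_ (by norm_num)
      nlinarith
    linarith
  · intro v v' s hs f
    obtain ⟨Φ, hΦ⟩ := exists_race_expect_eq (s := s / μ) hG hp0 hz f n
    have h3 : 0 < t * (s / μ) := by linarith [hy s hs]
    have h1 := hΦ v.1 v.2 (𝓐.up v.1 (t * (s / μ) / 2)) (𝓐.up v.2 (t * (s / μ) / 2))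
      (by rwa [hgap])
    have h2 := hΦ v'.1 v'.2 (𝓐.up v'.1 (t * (s / μ) / 2)) (𝓐.up v'.2 (t * (s / μ) / 2))
      (by rwa [hgap])
    simp only [𝓐.height_up, add_sub_cancel_left] at h1 h2
    exact h1.trans h2.symm
  · intro v s hs
    obtain ⟨h1, h2, h3, h4⟩ := hscale s hs
    refine le_trans ?_ (race_escapeValue hG hp0 hz (hy s hs) ?_ h1 (by rw [hp, hm]) (hinv v s hs) v)
    · rw [hgap]
      have h5 : s * (1 + 2 * t) ≤ s / μ * (1 - t) / 2 := by
        have h6 : s / μ * (1 - t) / 2 - s / μ * μ * (1 + 2 * t) = s / μ * (3 * t ^ 2) := by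
          rw [hμ]
          ring
        have h7 : 0 ≤ s / μ * (3 * t ^ 2) := by positivity
        rw [h4] at h6
        linarith
      have h6 : (q + 1 / 1228800) ^ 2 ≤ q ^ 2 * (1 + 2 * t) := by
        have h7 : q ^ 2 * (2 * t) = q / 409600 := by
          rw [ht, hm]
          field_simp
          norm_num
        nlinarith
      calc (q + 1 / 1228800) ^ 2 * s ≤ q ^ 2 * (1 + 2 * t) * s := by gcongr
        _ = q ^ 2 * (s * (1 + 2 * t)) := by ring
        _ ≤ q ^ 2 * (s / μ * (1 - t) / 2) := by gcongr
        _ = q ^ 2 / 2 * (s / μ - t * (s / μ)) := by ring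
    · have h5 : s / μ + q ^ 2 / 2 * (s / μ) ≤ 2 * q ^ 2 * (3 * s) := by
        have h6 : 1 + q ^ 2 / 2 ≤ 2 * q ^ 2 := by nlinarith
        calc s / μ + q ^ 2 / 2 * (s / μ) = (1 + q ^ 2 / 2) * (s / μ) := by ring
          _ ≤ 2 * q ^ 2 * (3 * s) := by gcongr
      refine h5.trans ?_
      have h7 : 2 * q ^ 2 * 3 ≤ (1280 * (q + 1 / 1228800)) ^ 2 := by nlinarith
      have := mul_le_mul_of_nonneg_right h7 hs.le
      linarith

theorem exists_isGadget (w : ℕ) : ∃ (X : Type) (𝓐 : Arena X) (z : ℝ) (G : X → ℝ → Adversary X X),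
    0 < z ∧ IsGadget 𝓐 (w + 1) (1 + w / 1228800) z G := by
  induction w with
  | zero => exact ⟨ℝ, Arena.real, 1, _, one_pos, by simpa using isGadget_real⟩
  | succ w ih =>
    obtain ⟨X, 𝓐, z, G, hz, hG⟩ := ih
    obtain ⟨z', G', hz', hG'⟩ := hG.exists_square (by omega)
      (le_add_of_nonneg_right (by positivity)) hz
    refine ⟨X × X, 𝓐.square, z', G', hz', ?_⟩
    convert hG' using 1
    push_cast
    ring

section Repeat

variable {X : Type} (𝓐 : Arena X) (G : X → ℝ → Adversary X X) (v : X)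

/-- `k` independent runs of a gadget at scale `1`, each of them followed by a forced excursion. -/
noncomputable def repeated : ℕ → Adversary X X
  | 0 => done v
  | k + 1 => (G v 1).graft (offer id ∅) fun _ =>
      req {v} (req {𝓐.up v 1} (req {v} (repeated k)))

variable {𝓐 G} {w : ℕ} {q z : ℝ} (hG : IsGadget 𝓐 w q z G)
include hG

theorem repeated_forallReq (hw : 1 ≤ w) (k : ℕ) :
    (repeated 𝓐 G v k).ForallReq fun r => r.Nonempty ∧ r.card ≤ w := by
  induction k with
  | zero => trivial
  | succ k ih =>
    refine forallReq_graft ((hG.forallReq v 1 one_pos).mono fun r hr => ⟨?_, ?_⟩)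
      (forall_of_forall _ fun l e => ⟨by simpa, by simpa, by simpa, ih⟩)
    · obtain ⟨x, hx⟩ := hr.1
      exact ⟨x, mem_offer.2 (.inl ⟨x, hx, rfl⟩)⟩
    · exact card_offer_le.trans (by simpa using hr.2.1)

theorem repeated_expect_le (k : ℕ) {g : List (Finset X) → ℝ} {c₀ : ℝ}
    (hg : ∀ l e c, Serves 𝓐.d l v e c → g l ≤ c₀ + c) :
    (repeated 𝓐 G v k).expect (fun l _ => g l) ≤ c₀ + 4 * k := by
  have hd := 𝓐.isMetric
  induction k generalizing g c₀ with
  | zero => simpa [repeated, expect] using hg [] v 0 ⟨rfl, le_rfl⟩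
  | succ k ih =>
    have h1 := expect_mono (T := G v 1) (f := fun l e => (req {v} (req {𝓐.up v 1} (req {v}
        (repeated 𝓐 G v k)))).expect fun l' _ => g (l.map (offer id ∅) ++ l'))
      (g := fun _ e => (c₀ + 2 + 4 * k) + 2 * (𝓐.h e - 𝓐.h v))
      ((hG.serves v 1 one_pos).mono fun l e he => by
        refine (ih (g := fun l' => g (l.map (offer id ∅) ++ {v} :: {𝓐.up v 1} :: {v} :: l'))
          (c₀ := c₀ + 2 + 2 * (𝓐.h e - 𝓐.h v)) fun l' e' c hc => ?_).trans_eq (by ring)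
        have h2 := Serves.image_union (f := id) (d' := 𝓐.d) (fun _ _ => rfl) ∅ he
        have h3 : Serves 𝓐.d ({v} :: {𝓐.up v 1} :: {v} :: l') (id e) e'
            (𝓐.h e - 𝓐.h v + 2 + c) := by
          refine ⟨v, by simp, 𝓐.up v 1, by simp, v, by simp, hc.mono ?_⟩
          have h4 := he.dist_le hd
          rw [hd.2.1 (id e) v, hd.2.1 (𝓐.up v 1) v, 𝓐.dist_up v 1 zero_le_one]
          simp only [id]
          linarith
        refine (hg _ _ _ (h2.append h3)).trans_eq (by ring))
    rw [expect_affine] at h1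
    have h2 := hG.expect_le v 1 one_pos
    rw [repeated, expect_graft]
    push_cast
    linarith

omit hG in
theorem repeated_le_serves (k : ℕ) : (repeated 𝓐 G v k).Forall fun l _ =>
    ∀ x e c, Serves 𝓐.d l x e c → (k : ℝ) ≤ c := by
  have hd := 𝓐.isMetric
  induction k with
  | zero =>
    rintro x e c ⟨rfl, hc⟩
    simpa using hc
  | succ k ih =>
    refine forall_graft.2 (forall_of_forall _ fun l e => ?_)
    refine Forall.mono (T := repeated 𝓐 G v k) ih fun l' e' h' x y c hc => ?_
    obtain ⟨u, v₁, h1, u₁, h2, v₂, h3, hc⟩ := Serves.exists_of_append hd hc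
    rw [Finset.mem_singleton] at h1 h2 h3
    rw [h1, h2, h3] at hc
    have h4 := h' _ _ _ hc
    have h5 := hd.nonneg u v
    rw [hd.2.1 (𝓐.up v 1) v, 𝓐.dist_up v 1 zero_le_one] at h4
    push_cast
    linarith

theorem repeated_escapeValue (k : ℕ) {P : ℝ} (hP : (1280 * q) ^ 2 + q ^ 2 * k ≤ P) :
    q ^ 2 * k ≤ (repeated 𝓐 G v k).escapeValue 𝓐.d P v := by
  have hd := 𝓐.isMetric
  induction k with
  | zero => simp [repeated, escapeValue]
  | succ k ih =>
    have h0 : 0 ≤ (1280 * q) ^ 2 := sq_nonneg _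
    have h1 : 0 ≤ q ^ 2 := sq_nonneg _
    push_cast at hP ⊢
    have h2 := ih (by linarith)
    have h3 := escapeValue_add_le_graft (d := 𝓐.d) (d' := 𝓐.d) hd.nonneg (f := id) (O := ∅)
      (P := (1280 * q) ^ 2 * 1) (P' := P) (S := Set.univ) (T := G v 1) (x := v)
      (k := fun _ => req {v} (req {𝓐.up v 1} (req {v} (repeated 𝓐 G v k))))
      (Ψ := fun _ => q ^ 2 * k) (fun _ _ => rfl) (by simp)
      ((hG.forallReq v 1 one_pos).mono fun _ _ _ _ => trivial)
      (forall_of_forall _ fun l e => ⟨by linarith, by linarith, fun y => ?_⟩) trivial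
    · have h4 := hG.le_escapeValue v 1 one_pos
      rw [expect_const] at h3
      rw [repeated]
      simp only [id] at h3
      linarith
    · refine le_escapeValue_req (by linarith) fun y₁ _ => ?_
      refine le_add_of_nonneg_of_le (hd.nonneg _ _)
        (le_escapeValue_req (by linarith) fun y₂ _ => ?_)
      refine le_add_of_nonneg_of_le (hd.nonneg _ _)
        (le_escapeValue_req (by linarith) fun y₃ hy => ?_)
      rw [Finset.mem_singleton.1 hy]
      exact le_add_of_nonneg_of_le (hd.nonneg _ _) h2

end Repeat

section Transfer

variable {M X F : Type} [Fintype M] (f : M → X)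

/-- The request on `M` corresponding to a request on `X`. -/
noncomputable def pullRequest (r : Finset X) : Finset M := Finset.univ.filter fun i => f i ∈ r

variable {f}

theorem mem_pullRequest {r : Finset X} {i : M} : i ∈ pullRequest f r ↔ f i ∈ r := by
  simp [pullRequest]

theorem pullRequest_nonempty {r : Finset X} (hr : r.Nonempty) (hf : ∀ y ∈ r, ∃ i, f i = y) :
    (pullRequest f r).Nonempty := by
  obtain ⟨y, hy⟩ := hr
  obtain ⟨i, rfl⟩ := hf y hy
  exact ⟨i, mem_pullRequest.2 hy⟩

theorem card_pullRequest_le (hf : Function.Injective f) (r : Finset X) :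
    (pullRequest f r).card ≤ r.card :=
  Finset.card_le_card_of_injOn f (fun _ hi => mem_pullRequest.1 hi) hf.injOn

omit [Fintype M] in
/-- The cost of the online algorithm `A` on `σ` after the history `hist`, starting at `x`. -/
noncomputable def costFrom (d : M → M → ℝ) (A : List (Finset M) → M) :
    List (Finset M) → M → List (Finset M) → ℝ
  | _, _, [] => 0
  | hist, x, r :: σ => d x (A (hist ++ [r])) + costFrom d A (hist ++ [r]) (A (hist ++ [r])) σ

omit [Fintype M] in
theorem mssCost_eq_costFrom (d : M → M → ℝ) (A : List (Finset M) → M) (s : M)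
    (σ : List (Finset M)) : mssCost d A s σ = costFrom d A [] s σ := by
  have key : ∀ (σ hist : List (Finset M)) (x : M), costFrom d A hist x σ =
      ∑ t ∈ Finset.range σ.length, d (if t = 0 then x else A (hist ++ σ.take t))
        (A (hist ++ σ.take (t + 1))) := by
    intro σ
    induction σ with
    | nil => simp [costFrom]
    | cons r σ ih =>
      intro hist x
      rw [costFrom, ih, List.length_cons, Finset.sum_range_succ', add_comm]
      congr 1
      · refine Finset.sum_congr rfl fun t _ => ?_
        cases t <;> simp
  rw [key]
  simp [mssCost, mssPoint]

theorem escapeValue_le_expect_costFrom {d : X → X → ℝ} {P : ℝ} {A : List (Finset M) → M}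
    (hA : MssAlg A) {T : Adversary X F}
    (hT : T.ForallReq fun r => r.Nonempty ∧ ∀ y ∈ r, ∃ i, f i = y) (hist : List (Finset M))
    (i : M) : T.escapeValue d P (f i) ≤
      T.expect fun l _ => costFrom (fun i j => d (f i) (f j)) A hist i (l.map (pullRequest f)) := by
  induction T generalizing hist i with
  | done e => simp [escapeValue, expect, costFrom]
  | req r n ih =>
    have h1 := mem_pullRequest.1 (hA hist _ (pullRequest_nonempty hT.1.1 hT.1.2))
    refine (escapeValue_req_le h1).trans ?_
    simp only [expect, List.map_cons, costFrom, expect_add, expect_const]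
    exact add_le_add_right (ih hT.2 _ _) _
  | flip a b iha ihb =>
    have h1 := iha hT.1 hist i
    have h2 := ihb hT.2 hist i
    simp only [escapeValue, expect]
    linarith

theorem Serves.exists_mssServes {d : X → X → ℝ} {l : List (Finset X)}
    (hl : ∀ r ∈ l, ∀ y ∈ r, ∃ i, f i = y) {i : M} {e : X} {c : ℝ} (h : Serves d l (f i) e c) :
    ∃ x : ℕ → M, MssServes i (l.map (pullRequest f)) x ∧
      ∑ t ∈ Finset.range (l.map (pullRequest f)).length, d (f (x t)) (f (x (t + 1))) ≤ c := by
  induction l generalizing i c with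
  | nil => exact ⟨fun _ => i, ⟨rfl, fun t ht => absurd ht (by simp)⟩, by simpa using h.2⟩
  | cons r l ih =>
    obtain ⟨y, hy, h⟩ := h
    obtain ⟨j, rfl⟩ := hl r (by simp) y hy
    obtain ⟨x, ⟨h1, h2⟩, h3⟩ := ih (fun r hr => hl r (by simp [hr])) h
    refine ⟨fun t => Nat.casesOn t i x, ⟨rfl, fun t ht => ?_⟩, ?_⟩
    · cases t with
      | zero => simpa [h1, mem_pullRequest] using hy
      | succ t => simpa using h2 t (by simpa using ht)
    · rw [List.map_cons, List.length_cons, Finset.sum_range_succ']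
      change ∑ t ∈ _, d (f (x t)) (f (x (t + 1))) + d (f i) (f (x 0)) ≤ c
      rw [h1]
      linarith

theorem MssServes.serves {d : X → X → ℝ} {l : List (Finset X)} {i : M} {x : ℕ → M}
    (h : MssServes i (l.map (pullRequest f)) x) :
    ∃ e, Serves d l (f i) e
      (∑ t ∈ Finset.range (l.map (pullRequest f)).length, d (f (x t)) (f (x (t + 1)))) := by
  induction l generalizing i x with
  | nil => exact ⟨f i, rfl, by simp⟩
  | cons r l ih =>
    obtain ⟨h1, h2⟩ := h
    obtain ⟨e, he⟩ := ih (i := x 1) (x := fun t => x (t + 1))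
      ⟨rfl, fun t ht => by simpa using h2 (t + 1) (by simpa using ht)⟩
    refine ⟨e, f (x 1), mem_pullRequest.1 (by simpa using h2 0 (by simp)), he.mono ?_⟩
    rw [List.map_cons, List.length_cons, Finset.sum_range_succ', ← h1]
    simp

omit [Fintype M] in
theorem Serves.exists_of_nonempty (d : X → X → ℝ) {l : List (Finset X)}
    (hl : ∀ r ∈ l, r.Nonempty) (x : X) : ∃ e c, Serves d l x e c := by
  induction l generalizing x with
  | nil => exact ⟨x, 0, rfl, le_rfl⟩
  | cons r l ih =>
    obtain ⟨y, hy⟩ := hl r (by simp)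
    obtain ⟨e, c, h⟩ := ih (fun r hr => hl r (by simp [hr])) y
    exact ⟨e, d x y + c, y, hy, h.mono (by linarith)⟩

theorem mssOpt_le_of_serves {d : X → X → ℝ} (hd : IsMetric d) {l : List (Finset X)}
    (hl : ∀ r ∈ l, ∀ y ∈ r, ∃ i, f i = y) {i : M} {e : X} {c : ℝ} (h : Serves d l (f i) e c) :
    mssOpt (fun i j => d (f i) (f j)) i (l.map (pullRequest f)) ≤ c := by
  obtain ⟨x, hx, hc⟩ := h.exists_mssServes hl
  have hb : mssOpt (fun i j => d (f i) (f j)) i (l.map (pullRequest f)) ≤ _ :=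
    csInf_le ⟨0, ?_⟩ ⟨x, hx, rfl⟩
  · exact hb.trans hc
  rintro _ ⟨x, -, rfl⟩
  exact Finset.sum_nonneg fun t _ => hd.nonneg _ _

theorem le_mssOpt_of_serves {d : X → X → ℝ} {l : List (Finset X)}
    (hl : ∀ r ∈ l, r.Nonempty ∧ ∀ y ∈ r, ∃ i, f i = y) {i : M} {b : ℝ}
    (h : ∀ e c, Serves d l (f i) e c → b ≤ c) :
    b ≤ mssOpt (fun i j => d (f i) (f j)) i (l.map (pullRequest f)) := by
  obtain ⟨e, c, hs⟩ := Serves.exists_of_nonempty d (fun r hr => (hl r hr).1) (f i)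
  obtain ⟨x, hx, -⟩ := hs.exists_mssServes fun r hr => (hl r hr).2
  refine le_csInf ⟨_, x, hx, rfl⟩ ?_
  rintro _ ⟨x, hx, rfl⟩
  obtain ⟨e, he⟩ := hx.serves (d := d)
  exact h _ _ he

end Transfer

theorem Adversary.ForallReq.and {M F : Type} {T : Adversary M F} {Q R : Finset M → Prop}
    (h : T.ForallReq Q) (h' : T.ForallReq R) : T.ForallReq fun r => Q r ∧ R r := by
  induction T with
  | done e => trivial
  | req r n ih => exact ⟨⟨h.1, h'.1⟩, ih h.2 h'.2⟩
  | flip a b iha ihb => exact ⟨iha h.1 h'.1, ihb h.2 h'.2⟩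

theorem Adversary.exists_forallReq_subset {M F : Type} (T : Adversary M F) :
    ∃ S : Finset M, T.ForallReq fun r => r ⊆ S := by
  induction T with
  | done e => exact ⟨∅, trivial⟩
  | req r n ih =>
    obtain ⟨S, hS⟩ := ih
    exact ⟨r ∪ S, Finset.subset_union_left,
      hS.mono fun _ h => h.trans Finset.subset_union_right⟩
  | flip a b iha ihb =>
    obtain ⟨S, hS⟩ := iha
    obtain ⟨S', hS'⟩ := ihb
    exact ⟨S ∪ S', hS.mono fun _ h => h.trans Finset.subset_union_left,
      hS'.mono fun _ h => h.trans Finset.subset_union_right⟩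

theorem exists_repeated_forallReq_subset {X : Type} (𝓐 : Arena X) (G : X → ℝ → Adversary X X)
    (v : X) : ∃ S : Finset X, v ∈ S ∧ ∀ k, (repeated 𝓐 G v k).ForallReq fun r => r ⊆ S := by
  obtain ⟨S, hS⟩ := (G v 1).exists_forallReq_subset
  have hsub : S ⊆ insert v (insert (𝓐.up v 1) S) := fun x hx => by simp [hx]
  refine ⟨insert v (insert (𝓐.up v 1) S), by simp, fun k => ?_⟩
  induction k with
  | zero => trivial
  | succ k ih =>
    refine forallReq_graft (hS.mono fun r hr y hy => ?_)
      (forall_of_forall _ fun l e => ⟨by simp, by simp, by simp, ih⟩)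
    obtain ⟨x, hx, rfl⟩ | hy := mem_offer.1 hy
    · exact hsub (hr hx)
    · simp at hy

theorem IsGadget.exists_mssDLB {X : Type} {𝓐 : Arena X} {w : ℕ} {q z : ℝ}
    {G : X → ℝ → Adversary X X} (hG : IsGadget 𝓐 w q z G) (hw : 1 ≤ w) :
    ∃ (n : ℕ) (d : Fin n → Fin n → ℝ), IsMetric d ∧ ∃ s : Fin n, MssDLB d s w (q ^ 2 / 4) := by
  have hd := 𝓐.isMetric
  obtain ⟨S, hv, hS⟩ := exists_repeated_forallReq_subset 𝓐 G 𝓐.base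
  set f : Fin S.card → X := fun i => S.equivFin.symm i with hf
  have hinj : Function.Injective f := Subtype.val_injective.comp S.equivFin.symm.injective
  have hsurj : ∀ y ∈ S, ∃ i, f i = y := fun y hy => ⟨S.equivFin ⟨y, hy⟩, by simp [hf]⟩
  obtain ⟨s, hs⟩ := hsurj _ hv
  refine ⟨S.card, fun i j => 𝓐.d (f i) (f j),
    ⟨fun i j => (hd.1 _ _).trans hinj.eq_iff, fun _ _ => hd.2.1 _ _, fun _ _ _ => hd.2.2 _ _ _⟩,
    s, fun B _ => ?_⟩
  obtain ⟨k, hk⟩ := exists_nat_ge B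
  set T := repeated 𝓐 G 𝓐.base k with hT
  have hcard : T.ForallReq fun r => r.Nonempty ∧ r.card ≤ w := repeated_forallReq _ hG hw k
  have hreq : T.ForallReq fun r => r.Nonempty ∧ ∀ y ∈ r, ∃ i, f i = y :=
    (hcard.and (hS k)).mono fun r hr => ⟨hr.1.1, fun y hy => hsurj y (hr.2 hy)⟩
  set opt : List (Finset X) → ℝ := fun l =>
    mssOpt (fun i j => 𝓐.d (f i) (f j)) s (l.map (pullRequest f)) with hopt
  have hlow : (k : ℝ) ≤ T.expect fun l _ => opt l := by
    rw [← expect_const T (k : ℝ)]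
    refine expect_mono ((hreq.forall_mem.and (repeated_le_serves _ k)).mono fun l e h => ?_)
    exact le_mssOpt_of_serves h.1 (h.2 _)
  have hupp : (T.expect fun l _ => opt l) ≤ 4 * k := by
    have h := repeated_expect_le 𝓐.base hG k (c₀ := 0)
      (g := fun l => if ∀ r ∈ l, ∀ y ∈ r, ∃ i, f i = y then opt l else 0) fun l e c h => by
        rw [zero_add]
        split_ifs with hl
        · exact mssOpt_le_of_serves hd hl (hs.symm ▸ h)
        · exact (hd.nonneg _ _).trans (h.dist_le hd)
    rw [zero_add] at h
    refine (expect_congr (hreq.forall_mem.mono fun l e hl => ?_)).trans_le h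
    rw [if_pos fun r hr => (hl r hr).2]
  obtain ⟨N, P, ρ, hP, hE, hQ⟩ := T.exists_distribution
  refine ⟨N, P, fun ω => (ρ ω).map (pullRequest f), hP, ?_, fun ω r hr => ?_, ?_, fun A hA => ?_⟩
  · simpa using hE fun _ => 1
  · obtain ⟨r, hr', rfl⟩ := List.mem_map.1 hr
    have h1 := hQ _ hreq.forall_mem ω r hr'
    have h2 := hQ _ hcard.forall_mem ω r hr'
    exact ⟨pullRequest_nonempty h1.1 h1.2, (card_pullRequest_le hinj r).trans h2.2⟩
  · exact hk.trans (hlow.trans_eq (hE opt).symm)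
  · have h1 := (repeated_escapeValue 𝓐.base hG k le_rfl).trans
      (hs ▸ escapeValue_le_expect_costFrom hA hreq [] s)
    simp only [mssCost_eq_costFrom]
    rw [hE opt, hE fun l => costFrom (fun i j => 𝓐.d (f i) (f j)) A [] s (l.map (pullRequest f))]
    refine le_trans ?_ h1
    have h2 := mul_le_mul_of_nonneg_left hupp (sq_nonneg q)
    linarith

theorem MssDLB.mono {M : Type} {d : M → M → ℝ} {s : M} {w : ℕ} {C C' : ℝ} (h : MssDLB d s w C)
    (hC : C' ≤ C) : MssDLB d s w C' := fun B hB => by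
  obtain ⟨N, P, ρ, h0, h1, h2, h3, h4⟩ := h B hB
  exact ⟨N, P, ρ, h0, h1, h2, h3, fun A hA =>
    (mul_le_mul_of_nonneg_right hC (hB.trans h3)).trans (h4 A hA)⟩

/-- There is an absolute constant `c > 0` such that for every
width `w ≥ 1` there is a finite metric space (realized as a metric `d` on
`Fin n`) and a starting point `s` such that `c·w²` is a distributional lower
bound for MSS with request sets of cardinality at most `w`. -/
theorem mss_width_lower_bound :
    ∃ c : ℝ, 0 < c ∧ ∀ w : ℕ, 1 ≤ w →
      ∃ (n : ℕ) (d : Fin n → Fin n → ℝ), IsMetric d ∧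
        ∃ s : Fin n, MssDLB d s w (c * (w : ℝ) ^ 2) := by
  refine ⟨(1 / 1228800) ^ 2 / 4, by norm_num, fun w hw => ?_⟩
  obtain ⟨w, rfl⟩ := Nat.exists_eq_add_of_le' hw
  obtain ⟨X, 𝓐, z, G, -, hG⟩ := exists_isGadget w
  obtain ⟨n, d, hd, s, h⟩ := hG.exists_mssDLB hw
  refine ⟨n, d, hd, s, h.mono ?_⟩
  have h1 : (0 : ℝ) ≤ w := w.cast_nonneg
  push_cast
  nlinarith
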